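/- For ℙ-almost every ω ∈ Ω, the Hausdorff dimension of the uniformly random self-similar set equals min{s, d}: dim_H F(ω) = min{s, d}. -/

import Mathlib

open MeasureTheory Filter Topology
open scoped ENNReal

noncomputable section

abbrev E (d : ℕ) : Type := EuclideanSpace ℝ (Fin d)

abbrev Od (d : ℕ) : Type := Matrix.orthogonalGroup (Fin d) ℝ

instance (d : ℕ) : MeasurableSpace (Od d) := borel _
instance (d : ℕ) : BorelSpace (Od d) := ⟨rfl⟩

/-- The action of an orthogonal matrix on Euclidean space, as a linear map. -/
def act (d : ℕ) (Q : Od d) : E d →ₗ[ℝ] E d :=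
  Matrix.toEuclideanLin (Q : Matrix (Fin d) (Fin d) ℝ)

/-- The set `J` of finite nonempty words: a word of length `k+1` is a function
`Fin (k+1) → Fin m`. -/
abbrev JW (m : ℕ) : Type := Σ k : ℕ, (Fin (k + 1) → Fin m)

noncomputable instance (m : ℕ) : DecidableEq (JW m) := fun _ _ => Classical.dec _

/-- The label space `(σ₋,σ₊) × O(d)`. -/
abbrev Label (d : ℕ) (σm σp : ℝ) : Type := ↥(Set.Ioo σm σp) × Od d

/-- The space `Ω` of labelled trees. -/
abbrev Omega (d m : ℕ) (σm σp : ℝ) : Type := JW m → Label d σm σp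

variable {d m : ℕ} {σm σp : ℝ}

/-- The similarity map `T_i^ω = r_i^ω • Q_i^ω` attached to the node `w`. -/
def Tnode (ω : Omega d m σm σp) (w : JW m) : E d →ₗ[ℝ] E d :=
  ((ω w).1 : ℝ) • act d (ω w).2

/-- The initial word `𝐢_{k+1}` (first `k+1` symbols) of an infinite word `i`. -/
def pre (i : ℕ → Fin m) (k : ℕ) : JW m := ⟨k, fun j => i j.1⟩

/-- `cumT ω i n = T_{𝐢_1} ∘ ⋯ ∘ T_{𝐢_n}`. -/
def cumT (ω : Omega d m σm σp) (i : ℕ → Fin m) : ℕ → (E d →ₗ[ℝ] E d)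
  | 0 => LinearMap.id
  | n + 1 => (cumT ω i n).comp (Tnode ω (pre i n))

/-- `cumR ω i n = 𝐫_{𝐢_n}^ω = r_{𝐢_1}^ω ⋯ r_{𝐢_n}^ω` (equal to 1 if `n = 0`). -/
def cumR (ω : Omega d m σm σp) (i : ℕ → Fin m) (n : ℕ) : ℝ :=
  ∏ k ∈ Finset.range n, ((ω (pre i k)).1 : ℝ)

/-- `𝐫_w^ω` for a finite word `w`. -/
def wordR (ω : Omega d m σm σp) {k : ℕ} (w : Fin k → Fin m) : ℝ :=
  ∏ j : Fin k, ((ω ⟨j.1, fun t => w (Fin.castLE j.2 t)⟩).1 : ℝ)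

/-- The `k`-th partial sum `a_{i_1} + T_{𝐢_1}(a_{i_2}) + ⋯ + T_{𝐢_1}∘⋯∘T_{𝐢_k}(a_{i_{k+1}})`. -/
def partialSum (a : Fin m → E d) (ω : Omega d m σm σp) (i : ℕ → Fin m) (k : ℕ) : E d :=
  ∑ n ∈ Finset.range (k + 1), cumT ω i n (a (i n))

/-- The point `π(i, ω)`. -/
def piMap (a : Fin m → E d) (ω : Omega d m σm σp) (i : ℕ → Fin m) : E d :=
  ∑' n : ℕ, cumT ω i n (a (i n))

/-- `cumTFrom ω i p q = T_{𝐢_{p+2}} ∘ ⋯ ∘ T_{𝐢_{p+1+q}}`. -/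
def cumTFrom (ω : Omega d m σm σp) (i : ℕ → Fin m) (p : ℕ) : ℕ → (E d →ₗ[ℝ] E d)
  | 0 => LinearMap.id
  | q + 1 => (cumTFrom ω i p q).comp (Tnode ω (pre i (p + 1 + q)))

/-- The random vector `x(i, ω, p)`. -/
def xMap (a : Fin m → E d) (ω : Omega d m σm σp) (i : ℕ → Fin m) (p : ℕ) : E d :=
  ∑' q : ℕ, cumTFrom ω i p q (a (i (p + 1 + q)))

/-- The uniform probability measure on `(σ₋, σ₊)`, as a measure on `ℝ`. -/
def unif (σm σp : ℝ) : Measure ℝ :=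
  (ENNReal.ofReal (σp - σm))⁻¹ • (volume.restrict (Set.Ioo σm σp))

/-- The uniform probability measure on `(σ₋, σ₊)`, as a measure on the subtype. -/
def unifSub (σm σp : ℝ) : Measure ↥(Set.Ioo σm σp) :=
  (ENNReal.ofReal (σp - σm))⁻¹ • ((volume : Measure ℝ).comap Subtype.val)

/-- The measure `λ × θ` on the label space. -/
def labelM (σm σp : ℝ) {d : ℕ} (θ : Measure (Od d)) : Measure (Label d σm σp) :=
  (unifSub σm σp).prod θ

/-- The cylinder `[w]` of a finite word `w`. -/
def cyl {m k : ℕ} (w : Fin k → Fin m) : Set (ℕ → Fin m) := {j | ∀ t : Fin k, j t.1 = w t}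

/-- The cylinder `[w]` of a node `w : JW m`. -/
def cylNode {m : ℕ} (w : JW m) : Set (ℕ → Fin m) := {j | ∀ t : Fin (w.1 + 1), j t.1 = w.2 t}

/-- The σ-algebra `𝓕_k` generated by the labels at nodes of length at most `k`. -/
def Fk (d m : ℕ) (σm σp : ℝ) (k : ℕ) : MeasurableSpace (Omega d m σm σp) :=
  ⨆ w : {w : JW m // w.1 + 1 ≤ k}, MeasurableSpace.comap (fun ω => ω w.1) inferInstance

/-- `P` is the product measure `(λ×θ)^J`: coordinates are independent with law `λ×θ`. -/
def IsProductLaw (θ : Measure (Od d)) (P : Measure (Omega d m σm σp)) : Prop :=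
  ∀ (S : Finset (JW m)) (A : JW m → Set (Label d σm σp)),
    (∀ w, MeasurableSet (A w)) →
    P {ω | ∀ w ∈ S, ω w ∈ A w} = ∏ w ∈ S, labelM σm σp θ (A w)

/-- The uniformly random self-similar set `F(ω)`. -/
def Fset (a : Fin m → E d) (ω : Omega d m σm σp) : Set (E d) := Set.range (piMap a ω)

/-- `w` is an initial subword of `v`. -/
def isPrefix {m : ℕ} (w v : JW m) : Prop :=
  ∃ h : w.1 ≤ v.1, ∀ t : Fin (w.1 + 1), v.2 (Fin.castLE (Nat.succ_le_succ h) t) = w.2 t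

end

open MeasureTheory Filter Topology
open scoped ENNReal
noncomputable section
namespace RSS
variable {d m : ℕ} {σm σp : ℝ}

lemma norm_act (Q : Od d) (v : E d) : ‖act d Q v‖ = ‖v‖ := by
  have h1 : inner ℝ (act d Q v) (act d Q v) = inner ℝ v v := by
    have hQ : ((Q : Matrix (Fin d) (Fin d) ℝ)).transpose * (Q : Matrix (Fin d) (Fin d) ℝ) = 1 := by
      have := (Matrix.mem_orthogonalGroup_iff' (Fin d) ℝ).1 Q.2
      simpa [Matrix.star_eq_conjTranspose] using this
    unfold act
    rw [← LinearMap.adjoint_inner_right, ← Matrix.toEuclideanLin_conjTranspose_eq_adjoint]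
    have : (Matrix.toEuclideanLin (Q : Matrix (Fin d) (Fin d) ℝ).conjTranspose)
        ((Matrix.toEuclideanLin (Q : Matrix (Fin d) (Fin d) ℝ)) v) = v := by
      ext i
      simp [Matrix.toLpLin_apply, Matrix.conjTranspose_eq_transpose_of_trivial,
        Matrix.mulVec_mulVec, hQ]
    rw [this]
  rw [real_inner_self_eq_norm_sq, real_inner_self_eq_norm_sq] at h1
  exact (sq_eq_sq₀ (norm_nonneg _) (norm_nonneg _)).1 h1

lemma act_mul (Q R : Od d) (v : E d) : act d (Q * R) v = act d Q (act d R v) := by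
  ext i
  simp [act, Matrix.toLpLin_apply, Matrix.mulVec_mulVec]

lemma exists_act (v w : E d) (h : ‖v‖ = ‖w‖) : ∃ Q : Od d, act d Q v = w := by
  let R := (Submodule.span ℝ {v - w})ᗮ.reflection
  have hR : R v = w := Submodule.reflection_sub h
  let b := EuclideanSpace.basisFun (Fin d) ℝ
  refine ⟨⟨LinearMap.toMatrix b.toBasis b.toBasis R.toLinearEquiv.toLinearMap, ?_⟩, ?_⟩
  · rw [Matrix.mem_orthogonalGroup_iff']
    ext i j
    have : inner ℝ (R (b i)) (R (b j)) = inner ℝ (b i) (b j) := R.inner_map_map _ _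
    rw [b.inner_eq_ite] at this
    simp only [Matrix.mul_apply, Matrix.one_apply]
    rw [← this, ← b.sum_inner_mul_inner]
    refine Finset.sum_congr rfl fun k _ => ?_
    rw [Matrix.transpose_apply, LinearMap.toMatrix_apply, LinearMap.toMatrix_apply]
    simp [OrthonormalBasis.repr_apply_apply, real_inner_comm]
  · rw [← hR]
    unfold act
    have : Matrix.toEuclideanLin (LinearMap.toMatrix b.toBasis b.toBasis R.toLinearEquiv.toLinearMap)
      = R.toLinearEquiv.toLinearMap := by
      rw [Matrix.toEuclideanLin_eq_toLin_orthonormal, Matrix.toLin_toMatrix]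
    simp only [this]
    rfl

lemma measurable_act {α : Type*} [MeasurableSpace α] {Q : α → Od d} {v : α → E d}
    (hQ : Measurable Q) (hv : Measurable v) : Measurable fun x => act d (Q x) (v x) := by
  have hc : ∀ i j, Measurable fun Q : Od d => (Q : Matrix (Fin d) (Fin d) ℝ) i j := by
    intro i j
    apply Continuous.measurable
    exact (continuous_apply j).comp ((continuous_apply i).comp continuous_subtype_val)
  have : (fun x => act d (Q x) (v x)) = fun x => WithLp.toLp 2
      (fun i => ∑ j, ((Q x : Matrix (Fin d) (Fin d) ℝ) i j) * v x j) := by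
    funext x; ext i
    simp [act, Matrix.toLpLin_apply, Matrix.mulVec, dotProduct]
  rw [this]
  apply (WithLp.measurable_toLp 2 _).comp
  refine measurable_pi_lambda _ fun i => Finset.measurable_sum _ fun j _ => ?_
  refine ((hc i j).comp hQ).mul ?_
  exact (measurable_pi_apply j).comp ((WithLp.measurable_ofLp 2 _).comp hv)

instance : SecondCountableTopology (Od d) :=
  haveI : SecondCountableTopology (Matrix (Fin d) (Fin d) ℝ) :=
    inferInstanceAs (SecondCountableTopology (Fin d → Fin d → ℝ))
  Topology.IsInducing.subtypeVal.secondCountableTopology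

instance : ContinuousMul (Od d) := by infer_instance
instance : IsTopologicalGroup (Od d) := by infer_instance

lemma inv_eq (θ : Measure (Od d)) [IsProbabilityMeasure θ] [θ.IsMulLeftInvariant] :
    θ.inv = θ := by
  haveI : IsProbabilityMeasure θ.inv := by
    unfold Measure.inv; exact Measure.isProbabilityMeasure_map measurable_inv.aemeasurable
  refine Measure.ext_of_lintegral _ fun f hf => ?_
  calc ∫⁻ g, f g ∂θ.inv = ∫⁻ h, ∫⁻ g, f (g * h) ∂θ.inv ∂θ := by
        simp [lintegral_mul_right_eq_self (μ := θ.inv) f]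
    _ = ∫⁻ g, ∫⁻ h, f (g * h) ∂θ ∂θ.inv := by
        rw [lintegral_lintegral_swap]
        exact (hf.comp (measurable_snd.mul measurable_fst)).aemeasurable
    _ = ∫⁻ g, f g ∂θ := by
        simp [lintegral_mul_left_eq_self (μ := θ) f]

lemma right_inv (θ : Measure (Od d)) [IsProbabilityMeasure θ] [θ.IsMulLeftInvariant] :
    θ.IsMulRightInvariant := by
  rw [← inv_eq θ]; infer_instance

end RSS
end

open MeasureTheory Filter Topology
open scoped ENNReal
noncomputable section
namespace RSS
variable {d m : ℕ} {σm σp : ℝ}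

lemma unifSub_prob (h : σm < σp) : IsProbabilityMeasure (unifSub σm σp) := by
  constructor
  unfold unifSub
  rw [Measure.smul_apply, comap_subtype_coe_apply measurableSet_Ioo, smul_eq_mul]
  simp only [Set.image_univ, Subtype.range_coe_subtype, Set.setOf_mem_eq, Real.volume_Ioo]
  exact ENNReal.inv_mul_cancel (by simpa using h) ENNReal.ofReal_ne_top

lemma lintegral_unifSub (f : ℝ → ℝ≥0∞) :
    ∫⁻ r, f r ∂(unifSub σm σp) =
      (ENNReal.ofReal (σp - σm))⁻¹ * ∫⁻ r in Set.Ioo σm σp, f r := by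
  unfold unifSub
  rw [lintegral_smul_measure, smul_eq_mul, lintegral_subtype_comap measurableSet_Ioo]

lemma lintegral_norm_polar (hd : 1 ≤ d) (f : ℝ → ℝ≥0∞) (hf : Measurable f) :
    ∫⁻ v : E d, f ‖v‖ = (volume : Measure (E d)).toSphere Set.univ *
      ∫⁻ y in Set.Ioi (0:ℝ), ENNReal.ofReal (y ^ (d - 1)) * f y := by
  have hfr : Module.finrank ℝ (E d) = d := by simp
  calc ∫⁻ v : E d, f ‖v‖ = ∫⁻ x : ({(0)}ᶜ : Set (E d)), f (‖x.1‖) ∂((volume : Measure (E d)).comap (↑)) := by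
        haveI : Nontrivial (E d) := Module.nontrivial_of_finrank_pos (R := ℝ) (by rw [hfr]; omega)
        rw [lintegral_subtype_comap (measurableSet_singleton _).compl fun x : E d ↦ f (‖x‖),
          restrict_compl_singleton]
    _ = ∫⁻ x, f x.2 ∂(volume : Measure (E d)).toSphere.prod (.volumeIoiPow (d - 1)) := by
        have := (volume : Measure (E d)).measurePreserving_homeomorphUnitSphereProd.lintegral_comp_emb
          (Homeomorph.measurableEmbedding _) (f ∘ Subtype.val ∘ Prod.snd)
        rw [hfr] at this
        simpa using this
    _ = _ := by
        rw [lintegral_prod _ (by fun_prop)]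
        simp only [lintegral_const]
        rw [mul_comm, Measure.volumeIoiPow, lintegral_withDensity_eq_lintegral_mul _ (by fun_prop) (by fun_prop)]
        congr 1
        exact lintegral_subtype_comap measurableSet_Ioi fun y => ENNReal.ofReal (y ^ (d - 1)) * f y

lemma law_le (hd : 1 ≤ d) (h0 : 0 < σm) (h : σm < σp) (θ : Measure (Od d)) [IsProbabilityMeasure θ]
    [θ.IsMulLeftInvariant] {δ : ℝ} (hδ : 0 < δ) :
    ∃ C : ℝ≥0∞, C ≠ ⊤ ∧ ∀ x : E d, δ ≤ ‖x‖ → ∀ g : E d → ℝ≥0∞, Measurable g →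
      ∫⁻ l, g ((l.1 : ℝ) • act d l.2 x) ∂(labelM σm σp θ) ≤ C * ∫⁻ v, g v := by
  haveI := right_inv θ
  haveI := unifSub_prob h
  have hfr : Module.finrank ℝ (E d) = d := by simp
  haveI : Nontrivial (E d) := Module.nontrivial_of_finrank_pos (R := ℝ) (by rw [hfr]; omega)
  set K := (volume : Measure (E d)).toSphere Set.univ with hK
  have hK0 : K ≠ 0 := by
    rw [hK, Ne, Measure.measure_univ_eq_zero]; exact (volume : Measure (E d)).toSphere_ne_zero
  have hKt : K ≠ ⊤ := measure_ne_top _ _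
  set L := K * ENNReal.ofReal ((σm * δ) ^ (d - 1)) * ENNReal.ofReal δ with hL
  have hp : 0 < (σm * δ) ^ (d-1) := by positivity
  have hL0 : L ≠ 0 := by
    simp only [hL, ne_eq, mul_eq_zero, ENNReal.ofReal_eq_zero, not_or, not_le]
    exact ⟨⟨hK0, hp⟩, hδ⟩
  have hLt : L ≠ ⊤ := by finiteness
  have hs0 : ENNReal.ofReal (σp - σm) ≠ 0 := by simpa using h
  refine ⟨(ENNReal.ofReal (σp - σm))⁻¹ * L⁻¹, by
    exact ENNReal.mul_ne_top (ENNReal.inv_ne_top.2 hs0) (ENNReal.inv_ne_top.2 hL0), fun x hx g hg => ?_⟩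
  have hx0 : 0 < ‖x‖ := hδ.trans_le hx
  -- the averaged function
  let G : E d → ℝ≥0∞ := fun v => ∫⁻ Q, g (act d Q v) ∂θ
  have hGm : Measurable G := by
    apply Measurable.lintegral_prod_right' (f := fun p : E d × Od d => g (act d p.2 p.1))
    exact hg.comp (measurable_act measurable_snd measurable_fst)
  have hGn : ∀ v w : E d, ‖v‖ = ‖w‖ → G v = G w := by
    intro v w hvw
    obtain ⟨R, rfl⟩ := exists_act v w hvw
    simp only [G]
    rw [← lintegral_mul_right_eq_self (μ := θ) (fun Q => g (act d Q v)) R]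
    simp only [act_mul]
  let H : ℝ → ℝ≥0∞ := fun ρ => G ((ρ / ‖x‖) • x)
  have hHm : Measurable H := hGm.comp (by fun_prop)
  have hHG : ∀ v, H ‖v‖ = G v := by
    intro v
    apply hGn
    rw [norm_smul, norm_div, norm_norm, norm_norm, div_mul_cancel₀ _ hx0.ne']
  have hvol : ∀ Q : Od d, MeasurePreserving (act d Q) (volume : Measure (E d)) volume := by
    intro Q
    let e : E d →ₗᵢ[ℝ] E d := ⟨act d Q, norm_act Q⟩
    exact (e.toLinearIsometryEquiv rfl).measurePreserving
  have e1 : ∫⁻ v, g v = ∫⁻ v, G v := by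
    simp only [G]
    rw [lintegral_lintegral_swap (by exact (hg.comp (measurable_act measurable_snd measurable_fst)).aemeasurable)]
    have : ∀ Q, ∫⁻ v, g (act d Q v) = ∫⁻ v, g v := fun Q => (hvol Q).lintegral_comp hg
    simp [this]
  have e2 : ∫⁻ v, G v = K * ∫⁻ y in Set.Ioi (0:ℝ), ENNReal.ofReal (y ^ (d - 1)) * H y := by
    rw [← lintegral_norm_polar hd H hHm]
    simp [hHG]
  have e3 : ∫⁻ l, g ((l.1 : ℝ) • act d l.2 x) ∂(labelM σm σp θ) =
      (ENNReal.ofReal (σp - σm))⁻¹ * ∫⁻ r in Set.Ioo σm σp, H (r * ‖x‖) := by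
    unfold labelM
    rw [lintegral_prod _ (by
      apply Measurable.aemeasurable
      apply hg.comp
      exact (measurable_subtype_coe.comp measurable_fst).smul (measurable_act measurable_snd measurable_const))]
    rw [← lintegral_unifSub]
    congr 1; funext r
    simp only [H, G]
    congr 1; funext Q
    rw [mul_div_cancel_right₀ _ hx0.ne', map_smul]
  have e4 : ∫⁻ y in Set.Ioi (0:ℝ), ENNReal.ofReal (y ^ (d - 1)) * H y ≥
      ENNReal.ofReal ((σm * δ) ^ (d - 1)) * (ENNReal.ofReal δ * ∫⁻ r in Set.Ioo σm σp, H (r * ‖x‖)) := by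
    have hcov : ∫⁻ y in (fun r => r * ‖x‖) '' Set.Ioo σm σp, ENNReal.ofReal (y ^ (d - 1)) * H y =
        ∫⁻ r in Set.Ioo σm σp, ENNReal.ofReal |‖x‖| * (ENNReal.ofReal ((r * ‖x‖) ^ (d - 1)) * H (r * ‖x‖)) := by
      apply lintegral_image_eq_lintegral_abs_deriv_mul measurableSet_Ioo
      · intro r _
        simpa using ((hasDerivAt_id r).mul_const ‖x‖).hasDerivWithinAt
      · intro a _ b _ hab
        exact mul_right_cancel₀ hx0.ne' hab
    calc _ ≤ ∫⁻ y in (fun r => r * ‖x‖) '' Set.Ioo σm σp, ENNReal.ofReal (y ^ (d - 1)) * H y := by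
          have hHm' : Measurable fun r => H (r * ‖x‖) := hHm.comp (by fun_prop)
          rw [hcov, ← lintegral_const_mul _ hHm',
            ← lintegral_const_mul _ (hHm'.const_mul _)]
          apply setLIntegral_mono' measurableSet_Ioo
          intro r hr
          rw [mul_left_comm]
          have h1 : (σm * δ) ^ (d-1) ≤ (r * ‖x‖) ^ (d-1) := by
            have := hr.1.le
            have := h0.trans hr.1
            gcongr
          gcongr
          exact hx.trans (le_abs_self _)
      _ ≤ _ := by
          apply lintegral_mono_set
          rintro _ ⟨r, hr, rfl⟩
          exact mul_pos (h0.trans hr.1) hx0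
  rw [e3, mul_assoc]
  gcongr
  rw [e1, e2, ← ENNReal.div_eq_inv_mul, ENNReal.le_div_iff_mul_le (Or.inl hL0) (Or.inl hLt), mul_comm, hL]
  calc _ = K * (ENNReal.ofReal ((σm * δ) ^ (d - 1)) * (ENNReal.ofReal δ * ∫⁻ r in Set.Ioo σm σp, H (r * ‖x‖))) := by ring
    _ ≤ _ := by gcongr

lemma lintegral_ball_rpow (hd : 1 ≤ d) {t : ℝ} (ht : t < d) (ht0 : 0 < t) :
    ∫⁻ v in Metric.ball (0 : E d) 1, ‖v‖ₑ ^ (-t) ≠ ⊤ := by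
  have hfr : Module.finrank ℝ (E d) = d := by simp
  haveI : Nontrivial (E d) := Module.nontrivial_of_finrank_pos (R := ℝ) (by rw [hfr]; omega)
  have := integrableOn_ball_of_norm_le_rpow (μ := (volume : Measure (E d))) (r := 1) (C := 1) (α := t)
    (f := fun v => ‖v‖ ^ (-t)) (by simpa using hd) (by simpa using ht)
    (by
      refine Eventually.of_forall fun v => ?_
      rw [Real.norm_of_nonneg (by positivity), one_mul]) (by
      apply Measurable.aestronglyMeasurable; fun_prop)
  have h2 := this.hasFiniteIntegral
  unfold HasFiniteIntegral at h2
  refine ne_of_lt (lt_of_le_of_lt (le_of_eq ?_) h2)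
  apply lintegral_congr_ae
  apply ae_restrict_of_ae
  have : ∀ᵐ v : E d, v ≠ 0 := by simp [ae_iff]
  filter_upwards [this] with v hv
  have hv : 0 < ‖v‖ := norm_pos_iff.2 hv
  rw [Real.enorm_eq_ofReal (by positivity), ← ENNReal.ofReal_rpow_of_pos hv, ofReal_norm_eq_enorm]

lemma label_bound (hd : 1 ≤ d) (h0 : 0 < σm) (h : σm < σp) (θ : Measure (Od d)) [IsProbabilityMeasure θ]
    [θ.IsMulLeftInvariant] {δ : ℝ} (hδ : 0 < δ) {t : ℝ} (ht : t < d) (ht0 : 0 < t) :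
    ∃ C : ℝ≥0∞, C ≠ ⊤ ∧ ∀ x y : E d, δ ≤ ‖x‖ →
      ∫⁻ l, ‖(l.1 : ℝ) • act d l.2 x - y‖ₑ ^ (-t) ∂(labelM σm σp θ) ≤ C := by
  obtain ⟨C, hC, hb⟩ := law_le hd h0 h θ hδ
  haveI := unifSub_prob h
  refine ⟨1 + C * ∫⁻ v in Metric.ball (0 : E d) 1, ‖v‖ₑ ^ (-t), ?_, fun x y hx => ?_⟩
  · exact ENNReal.add_ne_top.2 ⟨ENNReal.one_ne_top, ENNReal.mul_ne_top hC (lintegral_ball_rpow hd ht ht0)⟩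
  let g0 : E d → ℝ≥0∞ := (Metric.ball (0 : E d) 1).indicator fun v => ‖v‖ₑ ^ (-t)
  have hg0 : Measurable g0 := Measurable.indicator (by fun_prop) measurableSet_ball
  have hb' := hb x hx (fun v => g0 (v - y)) (by fun_prop)
  rw [lintegral_sub_right_eq_self g0 y, lintegral_indicator measurableSet_ball] at hb'
  calc _ ≤ ∫⁻ l, 1 + g0 ((l.1 : ℝ) • act d l.2 x - y) ∂(labelM σm σp θ) := by
        apply lintegral_mono
        intro l
        simp only [g0]
        by_cases hl : (l.1 : ℝ) • act d l.2 x - y ∈ Metric.ball (0 : E d) 1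
        · rw [Set.indicator_of_mem hl]; exact le_add_self
        · rw [Set.indicator_of_notMem hl, add_zero]
          apply ENNReal.rpow_le_one_of_one_le_of_neg _ (by linarith)
          rw [mem_ball_zero_iff, not_lt] at hl
          rw [← ofReal_norm_eq_enorm]
          rw [← ENNReal.ofReal_one]; exact ENNReal.ofReal_le_ofReal hl
    _ ≤ _ := by
        rw [lintegral_add_left measurable_const]
        refine add_le_add ?_ hb'
        simp [labelM]

end RSS
end

open MeasureTheory Filter Topology
open scoped ENNReal
noncomputable section
namespace RSS
variable {d m : ℕ} {σm σp : ℝ}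

lemma r_pos (h0 : 0 < σm) (l : Label d σm σp) : 0 < (l.1 : ℝ) := h0.trans l.1.2.1

lemma norm_Tnode (h0 : 0 < σm) (ω : Omega d m σm σp) (w : JW m) (v : E d) :
    ‖Tnode ω w v‖ = ((ω w).1 : ℝ) * ‖v‖ := by
  simp only [Tnode, LinearMap.smul_apply, norm_smul, norm_act, Real.norm_eq_abs,
    abs_of_pos (r_pos h0 (ω w))]

/-- composition of the maps at nodes `p, …, p+q-1` along `i`. -/
def cT (ω : Omega d m σm σp) (i : ℕ → Fin m) : ℕ → ℕ → (E d →ₗ[ℝ] E d)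
  | _, 0 => LinearMap.id
  | p, q + 1 => (Tnode ω (pre i p)).comp (cT ω i (p + 1) q)

lemma cT_succ' (ω : Omega d m σm σp) (i : ℕ → Fin m) (q p : ℕ) :
    cT ω i p (q + 1) = (cT ω i p q).comp (Tnode ω (pre i (p + q))) := by
  induction q generalizing p with
  | zero => rfl
  | succ q ih =>
    rw [cT, ih, cT, LinearMap.comp_assoc, show p + 1 + q = p + (q + 1) by ring]

lemma cumT_eq (ω : Omega d m σm σp) (i : ℕ → Fin m) (n : ℕ) : cumT ω i n = cT ω i 0 n := by
  induction n with
  | zero => rfl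
  | succ n ih => rw [cT_succ', cumT, ih, zero_add]

def tail (a : Fin m → E d) (ω : Omega d m σm σp) (i : ℕ → Fin m) (p : ℕ) : E d :=
  ∑' q : ℕ, cT ω i p q (a (i (p + q)))

lemma piMap_eq (a : Fin m → E d) (ω : Omega d m σm σp) (i : ℕ → Fin m) :
    piMap a ω i = tail a ω i 0 := by
  simp [piMap, tail, cumT_eq]

lemma norm_cT_le (h0 : 0 < σm) (ω : Omega d m σm σp) (i : ℕ → Fin m) (q p : ℕ) (v : E d) :
    ‖cT ω i p q v‖ ≤ σp ^ q * ‖v‖ := by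
  induction q generalizing p with
  | zero => simp [cT]
  | succ q ih =>
    rw [cT, LinearMap.comp_apply, norm_Tnode h0, pow_succ', mul_assoc]
    have h1 := (ω (pre i p)).1.2.2.le
    have h2 := r_pos h0 (ω (pre i p))
    exact mul_le_mul h1 (ih _) (norm_nonneg _) (h2.le.trans h1)

def amax (a : Fin m → E d) : ℝ := ∑ j, ‖a j‖

lemma le_amax (a : Fin m → E d) (j : Fin m) : ‖a j‖ ≤ amax a :=
  Finset.single_le_sum (f := fun j => ‖a j‖) (fun _ _ => norm_nonneg _) (Finset.mem_univ j)

lemma amax_nonneg (a : Fin m → E d) : 0 ≤ amax a := Finset.sum_nonneg fun _ _ => norm_nonneg _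

lemma term_le (h0 : 0 < σm) (h : σm < σp) (a : Fin m → E d) (ω : Omega d m σm σp) (i : ℕ → Fin m) (p q : ℕ) :
    ‖cT ω i p q (a (i (p + q)))‖ ≤ amax a * σp ^ q := by
  refine (norm_cT_le h0 ω i q p _).trans ?_
  rw [mul_comm]
  have := h0.trans h
  gcongr
  exact le_amax a _

lemma summable_bd (h0 : 0 < σm) (h : σm < σp) (h1 : σp < 1) (a : Fin m → E d) :
    Summable fun q : ℕ => amax a * σp ^ q :=
  (summable_geometric_of_lt_one (h0.trans h).le h1).mul_left _

lemma summable_tail (h0 : 0 < σm) (h : σm < σp) (h1 : σp < 1) (a : Fin m → E d) (ω : Omega d m σm σp)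
    (i : ℕ → Fin m) (p : ℕ) : Summable fun q => cT ω i p q (a (i (p + q))) :=
  Summable.of_norm_bounded (summable_bd h0 h h1 a) fun q => term_le h0 h a ω i p q

lemma norm_tail_le (h0 : 0 < σm) (h : σm < σp) (h1 : σp < 1) (a : Fin m → E d) (ω : Omega d m σm σp)
    (i : ℕ → Fin m) (p : ℕ) : ‖tail a ω i p‖ ≤ amax a * (1 - σp)⁻¹ := by
  have := tsum_of_norm_bounded ((hasSum_geometric_of_lt_one (h0.trans h).le h1).mul_left (amax a))
    (fun q => term_le h0 h a ω i p q)
  exact this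

lemma tail_rec (h0 : 0 < σm) (h : σm < σp) (h1 : σp < 1) (a : Fin m → E d) (ω : Omega d m σm σp)
    (i : ℕ → Fin m) (p : ℕ) : tail a ω i p = a (i p) + Tnode ω (pre i p) (tail a ω i (p + 1)) := by
  unfold tail
  rw [(summable_tail h0 h h1 a ω i p).tsum_eq_zero_add]
  congr 1
  have hs := summable_tail h0 h h1 a ω i (p+1)
  have := (LinearMap.toContinuousLinearMap (Tnode ω (pre i p))).map_tsum hs
  simp only [LinearMap.coe_toContinuousLinearMap'] at this
  rw [this]
  congr 1; funext q
  rw [cT, LinearMap.comp_apply, show p + 1 + q = p + (q+1) by ring]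

lemma pre_congr {i j : ℕ → Fin m} {l p : ℕ} (h : ∀ k < p, i k = j k) (hl : l < p) : pre i l = pre j l := by
  unfold pre
  congr 1
  funext t
  exact h _ (by omega)

lemma pre_ne {i j : ℕ → Fin m} {l p : ℕ} (h : i p ≠ j p) (hl : p ≤ l) : pre i l ≠ pre j l := by
  intro he
  simp only [pre, Sigma.mk.injEq, heq_eq_eq, true_and] at he
  exact h (congrFun he ⟨p, by omega⟩)

lemma pi_sub (h0 : 0 < σm) (h : σm < σp) (h1 : σp < 1) (a : Fin m → E d) (ω : Omega d m σm σp)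
    (i j : ℕ → Fin m) (p : ℕ) (hij : ∀ k < p, i k = j k) :
    piMap a ω i - piMap a ω j = cT ω i 0 p (tail a ω i p - tail a ω j p) := by
  induction p with
  | zero => simp [piMap_eq, cT]
  | succ p ih =>
    rw [ih fun k hk => hij k (by omega), cT_succ', tail_rec h0 h h1 a ω i p, tail_rec h0 h h1 a ω j p,
      hij p (by omega), zero_add, LinearMap.comp_apply, map_sub (Tnode _ _),
      add_sub_add_left_eq_sub, pre_congr hij (Nat.lt_succ_self p)]

lemma norm_cT (h0 : 0 < σm) (ω : Omega d m σm σp) (i : ℕ → Fin m) (p : ℕ) (v : E d) :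
    ‖cT ω i 0 p v‖ = cumR ω i p * ‖v‖ := by
  induction p generalizing v with
  | zero => simp [cT, cumR]
  | succ p ih =>
    rw [cT_succ', LinearMap.comp_apply, ih, norm_Tnode h0, cumR, cumR, Finset.prod_range_succ, zero_add]
    ring

lemma cT_congr (ω ω' : Omega d m σm σp) (i : ℕ → Fin m) (p q : ℕ)
    (h : ∀ l, p ≤ l → ω (pre i l) = ω' (pre i l)) : cT ω i p q = cT ω' i p q := by
  induction q generalizing p with
  | zero => rfl
  | succ q ih =>
    rw [cT, cT, ih (p+1) fun l hl => h l (by omega), Tnode, Tnode, h p le_rfl]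

lemma tail_congr (a : Fin m → E d) (ω ω' : Omega d m σm σp) (i : ℕ → Fin m) (p : ℕ)
    (h : ∀ l, p ≤ l → ω (pre i l) = ω' (pre i l)) : tail a ω i p = tail a ω' i p := by
  unfold tail
  congr 1; funext q; rw [cT_congr ω ω' i p q h]

lemma measurable_cT (i : ℕ → Fin m) (p q : ℕ) (v : E d) :
    Measurable fun ω : Omega d m σm σp => cT ω i p q v := by
  induction q generalizing p with
  | zero => simpa [cT] using measurable_const
  | succ q ih =>
    simp only [cT, LinearMap.comp_apply, Tnode, LinearMap.smul_apply]
    refine Measurable.smul (M := ℝ) (f := fun ω : Omega d m σm σp => ((ω (pre i p)).1 : ℝ)) ?_ (measurable_act ?_ (ih _))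
    · exact measurable_subtype_coe.comp (measurable_fst.comp (measurable_pi_apply _))
    · exact measurable_snd.comp (measurable_pi_apply _)

lemma measurable_tail (h0 : 0 < σm) (h : σm < σp) (h1 : σp < 1) (a : Fin m → E d) (i : ℕ → Fin m) (p : ℕ) :
    Measurable fun ω : Omega d m σm σp => tail a ω i p := by
  refine measurable_of_tendsto_metrizable (f := fun n ω => ∑ q ∈ Finset.range n, cT ω i p q (a (i (p + q)))) ?_ ?_
  · intro n
    exact Finset.measurable_sum _ fun q _ => measurable_cT i p q _
  · rw [tendsto_pi_nhds]
    intro ω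
    exact (summable_tail h0 h h1 a ω i p).hasSum.tendsto_sum_nat

lemma continuous_pi (h0 : 0 < σm) (h : σm < σp) (h1 : σp < 1) (a : Fin m → E d) (ω : Omega d m σm σp) :
    Continuous (piMap a ω) := by
  have : piMap a ω = fun i => ∑' q : ℕ, cT ω i 0 q (a (i (0 + q))) := by
    funext i; rw [piMap_eq]; rfl
  rw [this]
  refine continuous_tsum (u := fun q => amax a * σp ^ q) ?_ (summable_bd h0 h h1 a) (fun q i => term_le h0 h a ω i 0 q)
  intro q
  -- locally constant
  rw [continuous_iff_continuousAt]
  intro i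
  apply ContinuousAt.congr (f := fun _ => cT ω i 0 q (a (i (0 + q)))) continuousAt_const
  have : ∀ᶠ j in 𝓝 i, ∀ k ∈ Finset.range (q + 1), j k = i k := by
    rw [Filter.eventually_all_finset]
    intro k _
    have : Tendsto (fun j : ℕ → Fin m => j k) (𝓝 i) (𝓝 (i k)) := (continuous_apply k).tendsto i
    rw [nhds_discrete (Fin m), tendsto_pure] at this
    exact this
  filter_upwards [this] with j hj
  have hj' : ∀ k < q + 1, j k = i k := fun k hk => hj k (Finset.mem_range.2 hk)
  have : ∀ n ≤ q, cT ω j 0 n = cT ω i 0 n := by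
    intro n
    induction n with
    | zero => intro _; rfl
    | succ n ih =>
      intro hn
      rw [cT_succ', cT_succ', ih (by omega), zero_add, pre_congr hj' (by omega)]
  rw [this q le_rfl, hj' _ (by omega)]

lemma isCompact_F (h0 : 0 < σm) (h : σm < σp) (h1 : σp < 1) (a : Fin m → E d) (ω : Omega d m σm σp) :
    IsCompact (Fset a ω) := isCompact_range (continuous_pi h0 h h1 a ω)

section prob
variable {θ : Measure (Od d)} {P : Measure (Omega d m σm σp)}

lemma label_prob (h : σm < σp) (θ : Measure (Od d)) [IsProbabilityMeasure θ] :
    IsProbabilityMeasure (labelM σm σp θ) := by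
  haveI := unifSub_prob h
  unfold labelM; infer_instance

lemma measurable_update (u : JW m) :
    Measurable (fun x : Omega d m σm σp × Label d σm σp => Function.update x.1 u x.2) := by
  rw [measurable_pi_iff]
  intro w
  by_cases hw : w = u
  · subst hw; simpa using measurable_snd
  · simp only [Function.update_of_ne hw]; exact (measurable_pi_apply w).comp measurable_fst

lemma resample (h : σm < σp) [IsProbabilityMeasure θ] [IsProbabilityMeasure P]
    (hP : IsProductLaw θ P) (u : JW m) :
    (P.prod (labelM σm σp θ)).map (fun x => Function.update x.1 u x.2) = P := by
  haveI := label_prob h θ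
  have hm := measurable_update (d := d) (σm := σm) (σp := σp) u
  have e1 : P = Measure.infinitePi (fun _ : JW m => labelM σm σp θ) := by
    apply Measure.eq_infinitePi
    intro S A hA
    rw [← hP S A hA]; rfl
  rw [e1]
  refine Measure.eq_infinitePi _ ?_
  rw [← e1]
  intro S A hA
  rw [Measure.map_apply hm (MeasurableSet.pi (Finset.countable_toSet S) fun w _ => hA w)]
  have : (fun x : Omega d m σm σp × Label d σm σp => Function.update x.1 u x.2) ⁻¹' (Set.pi S A) =
      {ω | ∀ w ∈ S.erase u, ω w ∈ A w} ×ˢ (if u ∈ S then A u else Set.univ) := by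
    ext ⟨ω, l⟩
    simp only [Set.mem_preimage, Set.mem_pi, Finset.mem_coe, Set.mem_prod, Set.mem_setOf_eq, Finset.mem_erase]
    constructor
    · intro hx
      refine ⟨fun w hw => by simpa [Function.update_of_ne hw.1] using hx w hw.2, ?_⟩
      split_ifs with hu
      · simpa using hx u hu
      · trivial
    · rintro ⟨hx, hl⟩ w hw
      by_cases hwu : w = u
      · subst hwu; simpa [hw] using hl
      · simpa [Function.update_of_ne hwu] using hx w ⟨hwu, hw⟩
  rw [this, Measure.prod_prod, hP _ _ hA]
  split_ifs with hu
  · rw [mul_comm, Finset.mul_prod_erase S (fun w => labelM σm σp θ (A w)) hu]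
  · rw [measure_univ, mul_one, Finset.erase_eq_of_notMem hu]

lemma lintegral_resample (h : σm < σp) [IsProbabilityMeasure θ] [IsProbabilityMeasure P]
    (hP : IsProductLaw θ P) (u : JW m) (f : Omega d m σm σp → ℝ≥0∞) (hf : Measurable f) :
    ∫⁻ ω, f ω ∂P = ∫⁻ ω, ∫⁻ l, f (Function.update ω u l) ∂(labelM σm σp θ) ∂P := by
  haveI := label_prob h θ
  conv_lhs => rw [← resample h hP u]
  rw [lintegral_map hf (measurable_update u), lintegral_prod _ (by exact (hf.comp (measurable_update u)).aemeasurable)]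

lemma factor (h : σm < σp) [IsProbabilityMeasure θ] [IsProbabilityMeasure P]
    (hP : IsProductLaw θ P) (u : JW m) (f : Omega d m σm σp → ℝ≥0∞) (hf : Measurable f)
    (hfu : ∀ ω l, f (Function.update ω u l) = f ω)
    (g : Label d σm σp → ℝ≥0∞) (hg : Measurable g) :
    ∫⁻ ω, f ω * g (ω u) ∂P = (∫⁻ ω, f ω ∂P) * ∫⁻ l, g l ∂(labelM σm σp θ) := by
  rw [lintegral_resample h hP u _ (by exact hf.mul (hg.comp (measurable_pi_apply u)))]
  simp only [hfu, Function.update_self]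
  simp_rw [lintegral_const_mul _ hg]
  rw [lintegral_mul_const _ hf]

end prob
end RSS
end

open MeasureTheory Filter Topology
open scoped ENNReal
noncomputable section
namespace RSS

lemma amgm (y m : ℝ≥0∞) (hy0 : y ≠ 0) (hyt : y ≠ ⊤) : m ≤ y + y⁻¹ * m ^ 2 := by
  rcases le_total m y with h | h
  · exact h.trans le_self_add
  · refine le_trans ?_ le_add_self
    calc m = (y⁻¹ * y) * m := by rw [ENNReal.inv_mul_cancel hy0 hyt, one_mul]
      _ ≤ (y⁻¹ * m) * m := by gcongr
      _ = _ := by ring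

lemma cover_exists {X : Type*} [MetricSpace X] [MeasurableSpace X] [BorelSpace X] {F : Set X}
    (hF : IsCompact F) {t : ℝ} (ht : 0 < t) (h0 : Measure.hausdorffMeasure t F = 0)
    {η : ℝ≥0∞} (hη : η ≠ 0) :
    ∃ (S : Finset ℕ) (U : ℕ → Set X) (τ : ℕ → ℝ≥0∞), F ⊆ (⋃ k ∈ S, U k) ∧
      (∀ k, τ k ≠ 0 ∧ τ k ≠ ⊤) ∧ (∀ k, ∀ x ∈ U k, ∀ y ∈ U k, edist x y ≤ τ k) ∧
      ∑ k ∈ S, τ k ^ t ≤ η + η := by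
  have hη' : 0 < η := pos_iff_ne_zero.2 hη
  rw [Measure.hausdorffMeasure_apply] at h0
  have h1 := (iSup₂_le_iff.1 (le_of_eq h0)) 1 one_pos
  have h2 := lt_of_le_of_lt h1 hη'
  simp only [iInf_lt_iff] at h2
  obtain ⟨T, hT, hT1, hsum⟩ := h2
  obtain ⟨ε, hε0, hεs⟩ := ENNReal.exists_pos_sum_of_countable' hη ℕ
  have hδ : ∀ n, ∃ δ : ℝ, 0 < δ ∧ (Metric.ediam (T n) + 2 * ENNReal.ofReal δ) ^ t ≤ Metric.ediam (T n) ^ t + ε n := by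
    intro n
    have hD : Metric.ediam (T n) ≠ ⊤ := ne_top_of_le_ne_top ENNReal.one_ne_top (hT1 n)
    have hc : Tendsto (fun δ : ℝ => (Metric.ediam (T n) + 2 * ENNReal.ofReal δ) ^ t) (𝓝[>] 0)
        (𝓝 ((Metric.ediam (T n) + 2 * ENNReal.ofReal 0) ^ t)) := by
      apply Tendsto.mono_left _ nhdsWithin_le_nhds
      refine (ENNReal.continuous_rpow_const.tendsto _).comp ?_
      refine Tendsto.add tendsto_const_nhds ?_
      exact ENNReal.Tendsto.const_mul (ENNReal.tendsto_ofReal tendsto_id) (Or.inr (by simp))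
    simp only [ENNReal.ofReal_zero, mul_zero, add_zero] at hc
    have hlt : Metric.ediam (T n) ^ t < Metric.ediam (T n) ^ t + ε n :=
      ENNReal.lt_add_right (ENNReal.rpow_ne_top_of_nonneg ht.le hD) (hε0 n).ne'
    obtain ⟨δ, h1, h2⟩ := ((hc.eventually (gt_mem_nhds hlt)).and self_mem_nhdsWithin).exists
    exact ⟨δ, h2, h1.le⟩
  choose δ hδ0 hδ1 using hδ
  obtain ⟨S, hS⟩ := hF.elim_finite_subcover (fun n => Metric.thickening (δ n) (T n))
    (fun n => Metric.isOpen_thickening) (hT.trans (Set.iUnion_mono fun n => Metric.self_subset_thickening (hδ0 n) _))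
  refine ⟨S, fun n => Metric.thickening (δ n) (T n), fun n => Metric.ediam (T n) + 2 * ENNReal.ofReal (δ n), hS, ?_, ?_, ?_⟩
  · intro k
    constructor
    · have : ENNReal.ofReal (δ k) ≠ 0 := by simpa using hδ0 k
      simp [this]
    · have hD : Metric.ediam (T k) ≠ ⊤ := ne_top_of_le_ne_top ENNReal.one_ne_top (hT1 k)
      finiteness
  · intro k x hx y hy
    obtain ⟨x', hx', hxx⟩ := Metric.mem_thickening_iff.1 hx
    obtain ⟨y', hy', hyy⟩ := Metric.mem_thickening_iff.1 hy
    have e1 : edist x x' ≤ ENNReal.ofReal (δ k) := by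
      rw [edist_dist]; exact ENNReal.ofReal_le_ofReal hxx.le
    have e2 : edist y' y ≤ ENNReal.ofReal (δ k) := by
      rw [edist_comm, edist_dist]; exact ENNReal.ofReal_le_ofReal hyy.le
    calc edist x y ≤ edist x x' + edist x' y' + edist y' y := edist_triangle4 _ _ _ _
      _ ≤ ENNReal.ofReal (δ k) + Metric.ediam (T k) + ENNReal.ofReal (δ k) := by
          gcongr; exact Metric.edist_le_ediam_of_mem hx' hy'
      _ = _ := by ring
  · have hterm : ∀ n, (⨆ _ : (T n).Nonempty, Metric.ediam (T n) ^ t) = Metric.ediam (T n) ^ t := by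
      intro n
      rcases (T n).eq_empty_or_nonempty with h | h
      · simp [h, ht]
      · simp [h]
    simp only [hterm] at hsum
    calc _ ≤ ∑' n, (Metric.ediam (T n) ^ t + ε n) :=
          (Finset.sum_le_sum fun n _ => hδ1 n).trans (ENNReal.sum_le_tsum S)
      _ = _ := ENNReal.tsum_add
      _ ≤ η + η := add_le_add hsum.le hεs.le

lemma haus_ne_zero {X : Type*} [MetricSpace X] [MeasurableSpace X] [BorelSpace X] {F : Set X}
    (hF : IsCompact F) {t : ℝ} (ht : 0 < t) {K : ℝ≥0∞} (hK : K ≠ ⊤)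
    (H : ∀ ε : ℝ≥0∞, ε ≠ 0 → ∃ (ι : Type) (_ : Fintype ι) (_ : DecidableEq ι) (x : ι → X) (p : ι → ℝ≥0∞),
      (∀ i, x i ∈ F) ∧ 2⁻¹ ≤ ∑ i, p i ∧ ∑ i, p i ≤ 2 ∧ (∀ i, p i ≤ ε) ∧
      ∑ i, ∑ j, (if i = j then 0 else p i * p j * edist (x i) (x j) ^ (-t)) ≤ K) :
    Measure.hausdorffMeasure t F ≠ 0 := by
  intro h0
  set A : ℝ≥0∞ := 4 * (K + 1) with hA
  have hA0 : A ≠ 0 := by simp [hA]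
  have hAt : A ≠ ⊤ := by rw [hA]; finiteness
  set η : ℝ≥0∞ := (16 * A)⁻¹ with hηd
  have hη : η ≠ 0 := ENNReal.inv_ne_zero.2 (by finiteness)
  obtain ⟨S, U, τ, hcov, hτ, hdiam, hsum⟩ := cover_exists hF ht h0 hη
  set W : ℝ≥0∞ := ∑ k ∈ S, τ k ^ (-t) with hW
  have hWt : W ≠ ⊤ := by
    rw [hW, ENNReal.sum_ne_top]
    intro k _
    rw [ENNReal.rpow_neg]
    exact ENNReal.inv_ne_top.2 (by simp [ENNReal.rpow_eq_zero_iff, (hτ k).1, (hτ k).2])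
  obtain ⟨ι, _, _, x, p, hxF, hM1, hM2, hpε, hI⟩ := H ((2 * W + 1)⁻¹) (ENNReal.inv_ne_zero.2 (by finiteness))
  have hc : ∀ i, ∃ k ∈ S, x i ∈ U k := by
    intro i
    simpa using hcov (hxF i)
  choose c hcS hcU using hc
  have hM : ∑ i, p i = ∑ k ∈ S, ∑ i with c i = k, p i :=
    (Finset.sum_fiberwise_of_maps_to (fun i _ => hcS i) p).symm
  -- each piece
  have hpiece : ∀ k ∈ S, ∑ i with c i = k, p i ≤ A * τ k ^ t +
      A⁻¹ * (τ k ^ (-t) * (∑ i with c i = k, p i) ^ 2) := by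
    intro k _
    have h1 : τ k ^ t ≠ 0 := by simp [ENNReal.rpow_eq_zero_iff, (hτ k).1, (hτ k).2]
    have h2 : τ k ^ t ≠ ⊤ := ENNReal.rpow_ne_top_of_nonneg ht.le (hτ k).2
    have := amgm (A * τ k ^ t) (∑ i with c i = k, p i) (mul_ne_zero hA0 h1) (ENNReal.mul_ne_top hAt h2)
    rw [ENNReal.mul_inv (Or.inl hA0) (Or.inl hAt), ← ENNReal.rpow_neg] at this
    rwa [mul_assoc A⁻¹] at this
  have hsq : ∀ k ∈ S, τ k ^ (-t) * (∑ i with c i = k, p i) ^ 2 ≤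
      (∑ i, p i * (2 * W + 1)⁻¹) * τ k ^ (-t) +
      ∑ i with c i = k, ∑ j, (if i = j then 0 else p i * p j * edist (x i) (x j) ^ (-t)) := by
    intro k _
    rw [sq, Finset.sum_mul_sum, Finset.mul_sum]
    calc _ ≤ ∑ i with c i = k, (p i * (2 * W + 1)⁻¹ * τ k ^ (-t) +
            ∑ j, (if i = j then 0 else p i * p j * edist (x i) (x j) ^ (-t))) := by
          apply Finset.sum_le_sum
          intro i hi
          simp only [Finset.mem_filter, Finset.mem_univ, true_and] at hi
          rw [Finset.mul_sum]
          calc _ ≤ ∑ j with c j = k, ((if i = j then p i * (2 * W + 1)⁻¹ * τ k ^ (-t) else 0) +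
                (if i = j then 0 else p i * p j * edist (x i) (x j) ^ (-t))) := by
                apply Finset.sum_le_sum
                intro j hj
                simp only [Finset.mem_filter, Finset.mem_univ, true_and] at hj
                split_ifs with hij
                · subst hij
                  rw [add_zero, mul_comm]
                  gcongr
                  exact hpε _
                · rw [zero_add, mul_comm]
                  refine mul_le_mul' le_rfl ?_
                  rw [ENNReal.rpow_neg, ENNReal.rpow_neg]
                  exact ENNReal.inv_le_inv.2 (ENNReal.rpow_le_rpow (hdiam k _ (hi ▸ hcU i) _ (hj ▸ hcU j)) ht.le)
            _ ≤ ∑ j, ((if i = j then p i * (2 * W + 1)⁻¹ * τ k ^ (-t) else 0) +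
                (if i = j then 0 else p i * p j * edist (x i) (x j) ^ (-t))) :=
                Finset.sum_le_sum_of_subset (Finset.filter_subset _ _)
            _ = _ := by
                rw [Finset.sum_add_distrib]
                simp
      _ ≤ _ := by
          rw [Finset.sum_add_distrib, Finset.sum_mul]
          gcongr
          exact Finset.filter_subset _ _
  have htot : ∑ k ∈ S, τ k ^ (-t) * (∑ i with c i = k, p i) ^ 2 ≤ 1 + K := by
    refine (Finset.sum_le_sum hsq).trans ?_
    rw [Finset.sum_add_distrib, ← Finset.mul_sum, ← hW]
    refine add_le_add ?_ ?_
    · rw [← Finset.sum_mul]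
      calc _ ≤ 2 * (2 * W + 1)⁻¹ * W := by gcongr
        _ = (2 * W) * (2 * W + 1)⁻¹ := by ring
        _ ≤ (2 * W + 1) * (2 * W + 1)⁻¹ := by gcongr; exact le_self_add
        _ ≤ 1 := ENNReal.mul_inv_le_one _
    · rw [Finset.sum_fiberwise_of_maps_to (fun i _ => hcS i)]
      exact hI
  have hfin : ∑ i, p i ≤ 8⁻¹ + 4⁻¹ := by
    rw [hM]
    refine (Finset.sum_le_sum hpiece).trans ?_
    rw [Finset.sum_add_distrib, ← Finset.mul_sum, ← Finset.mul_sum]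
    refine add_le_add ?_ ?_
    · calc _ ≤ A * (η + η) := by gcongr
        _ = (A * A⁻¹) * (2 * 16⁻¹) := by
            rw [hηd, ENNReal.mul_inv (Or.inl (by norm_num)) (Or.inl (by norm_num))]; ring
        _ ≤ 1 * (2 * 16⁻¹) := by gcongr; exact ENNReal.mul_inv_le_one _
        _ = 8⁻¹ := by
            rw [one_mul, show (16 : ℝ≥0∞) = 2 * 8 by norm_num, ENNReal.mul_inv (by norm_num) (by norm_num),
              ← mul_assoc, ENNReal.mul_inv_cancel (by norm_num) (by norm_num), one_mul]
    · calc _ ≤ A⁻¹ * (1 + K) := by gcongr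
        _ = 4⁻¹ * ((K + 1) * (K + 1)⁻¹) := by
            rw [hA, ENNReal.mul_inv (by norm_num) (by norm_num)]; ring
        _ ≤ 4⁻¹ * 1 := by gcongr; exact ENNReal.mul_inv_le_one _
        _ = _ := mul_one _
  have := hM1.trans hfin
  have h3 : ((2⁻¹ : ℝ≥0∞)) ≤ ENNReal.ofReal (8⁻¹ + 4⁻¹) := by
    rw [ENNReal.ofReal_add (by norm_num) (by norm_num), ENNReal.ofReal_inv_of_pos (by norm_num),
      ENNReal.ofReal_inv_of_pos (by norm_num)]
    simpa using this
  have h4 : ((2⁻¹ : ℝ≥0∞)) = ENNReal.ofReal 2⁻¹ := by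
    rw [ENNReal.ofReal_inv_of_pos (by norm_num)]; simp
  rw [h4, ENNReal.ofReal_le_ofReal_iff (by norm_num)] at h3
  norm_num at h3

end RSS
end

open MeasureTheory Filter Topology
open scoped ENNReal
noncomputable section
namespace RSS
variable {d m : ℕ} {σm σp : ℝ}

/-- contraction ratio as an extended nonnegative real. -/
def R (l : Label d σm σp) : ℝ≥0∞ := ENNReal.ofReal (l.1 : ℝ)

lemma measurable_R : Measurable (R : Label d σm σp → ℝ≥0∞) :=
  ENNReal.measurable_ofReal.comp (measurable_subtype_coe.comp measurable_fst)

lemma R_ne_zero (h0 : 0 < σm) (l : Label d σm σp) : R l ≠ 0 := by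
  simpa [R] using r_pos h0 l

lemma R_ne_top (l : Label d σm σp) : R l ≠ ⊤ := ENNReal.ofReal_ne_top

lemma R_le (l : Label d σm σp) : R l ≤ ENNReal.ofReal σp := ENNReal.ofReal_le_ofReal l.1.2.2.le

lemma le_R (l : Label d σm σp) : ENNReal.ofReal σm ≤ R l := ENNReal.ofReal_le_ofReal l.1.2.1.le

/-- weights. -/
def wt (m : ℕ) (s : ℝ) (k l : ℕ) (x : Label d σm σp) : ℝ≥0∞ := if l < k then (m : ℝ≥0∞)⁻¹ else R x ^ s

lemma measurable_wt (s : ℝ) (k l : ℕ) : Measurable (wt m s k l : Label d σm σp → ℝ≥0∞) := by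
  unfold wt
  split_ifs
  · exact measurable_const
  · exact measurable_R.pow_const _

lemma wt_le (h1 : σp < 1) {s : ℝ} (hs : 0 < s) (k l : ℕ) (x : Label d σm σp) :
    wt m s k l x ≤ max (m : ℝ≥0∞)⁻¹ (ENNReal.ofReal σp ^ s) := by
  unfold wt
  split_ifs
  · exact le_max_left _ _
  · exact (ENNReal.rpow_le_rpow (R_le x) hs.le).trans (le_max_right _ _)

lemma S_pow_lt (h1 : σp < 1) {s : ℝ} (hs : 0 < s) : ENNReal.ofReal σp ^ s < 1 :=
  ENNReal.rpow_lt_one (by simpa using h1) hs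

lemma q_lt (hm : 2 ≤ m) (h1 : σp < 1) {s : ℝ} (hs : 0 < s) :
    max (m : ℝ≥0∞)⁻¹ (ENNReal.ofReal σp ^ s) < 1 := by
  refine max_lt ?_ (S_pow_lt h1 hs)
  rw [ENNReal.inv_lt_one]
  exact_mod_cast hm

lemma prod_ite_range {α : Type*} [CommMonoid α] (A B : α) (k p : ℕ) :
    ∏ l ∈ Finset.range p, (if l < k then A else B) = A ^ (min p k) * B ^ (p - k) := by
  induction p with
  | zero => simp
  | succ p ih =>
    rw [Finset.prod_range_succ, ih]
    split_ifs with hp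
    · rw [min_eq_left hp.le, min_eq_left (by omega), show p - k = 0 by omega, show p + 1 - k = 0 by omega]
      simp [pow_succ]
    · rw [min_eq_right (by omega), min_eq_right (by omega), show p + 1 - k = (p - k) + 1 by omega, pow_succ,
        mul_assoc]

section
variable {θ : Measure (Od d)} [IsProbabilityMeasure θ] {s : ℝ}

lemma int_wt (h : σm < σp) (hx : ∫⁻ l, R l ^ s ∂(labelM σm σp θ) = (m : ℝ≥0∞)⁻¹) (k l : ℕ) :
    ∫⁻ x, wt m s k l x ∂(labelM σm σp θ) = (m : ℝ≥0∞)⁻¹ := by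
  haveI := label_prob h θ
  unfold wt
  split_ifs
  · simp
  · exact hx

lemma int_pow (h0 : 0 < σm) (hx : ∫⁻ l, R l ^ s ∂(labelM σm σp θ) = (m : ℝ≥0∞)⁻¹) {u : ℝ} (hu : 0 ≤ u) :
    ∫⁻ l, R l ^ (s + u) ∂(labelM σm σp θ) ≤ ENNReal.ofReal σp ^ u * (m : ℝ≥0∞)⁻¹ := by
  rw [← hx, ← lintegral_const_mul _ (measurable_R.pow_const _)]
  apply lintegral_mono
  intro l
  dsimp only
  rw [ENNReal.rpow_add _ _ (R_ne_zero h0 l) (R_ne_top l), mul_comm]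
  exact mul_le_mul' (ENNReal.rpow_le_rpow (R_le l) hu) le_rfl

lemma int_wt_sq (hm : 0 < m) (h0 : 0 < σm) (h : σm < σp) (hs : 0 < s)
    (hx : ∫⁻ l, R l ^ s ∂(labelM σm σp θ) = (m : ℝ≥0∞)⁻¹) (k l : ℕ) :
    ∫⁻ x, wt m s k l x * wt m s k l x ∂(labelM σm σp θ) ≤
      (m : ℝ≥0∞)⁻¹ ^ 2 * (if l < k then 1 else ENNReal.ofReal σp ^ s * m) := by
  haveI := label_prob h θ
  unfold wt
  split_ifs
  · simp [sq]
  · have := int_pow h0 hx hs.le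
    simp_rw [fun l : Label d σm σp => ENNReal.rpow_add s s (R_ne_zero h0 l) (R_ne_top l)] at this
    refine this.trans (le_of_eq ?_)
    rw [sq, mul_comm, mul_comm (ENNReal.ofReal σp ^ s), ← mul_assoc, mul_assoc _ _ (m : ℝ≥0∞),
      ENNReal.inv_mul_cancel (by exact_mod_cast hm.ne') (by simp), mul_one]

lemma int_wt_en (hm : 0 < m) (h0 : 0 < σm) (h : σm < σp) {t : ℝ} (ht0 : 0 < t) (ht : t < s)
    (hx : ∫⁻ l, R l ^ s ∂(labelM σm σp θ) = (m : ℝ≥0∞)⁻¹) (k l : ℕ) :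
    ∫⁻ x, wt m s k l x * wt m s k l x * R x ^ (-t) ∂(labelM σm σp θ) ≤
      (m : ℝ≥0∞)⁻¹ * (if l < k then ENNReal.ofReal σm ^ (-t) else ENNReal.ofReal σp ^ (s - t)) := by
  haveI := label_prob h θ
  unfold wt
  split_ifs
  · calc _ ≤ ∫⁻ x : Label d σm σp, (m : ℝ≥0∞)⁻¹ * ENNReal.ofReal σm ^ (-t) ∂(labelM σm σp θ) := by
          apply lintegral_mono
          intro x
          refine mul_le_mul' ?_ ?_
          · refine mul_le_of_le_one_right' ?_
            rw [ENNReal.inv_le_one]; exact_mod_cast hm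
          · rw [ENNReal.rpow_neg, ENNReal.rpow_neg]
            exact ENNReal.inv_le_inv.2 (ENNReal.rpow_le_rpow (le_R x) ht0.le)
      _ = _ := by simp
  · have := int_pow h0 hx (u := s - t) (by linarith)
    rw [mul_comm]
    refine le_trans (le_of_eq ?_) this
    congr 1; funext x
    rw [← ENNReal.rpow_add _ _ (R_ne_zero h0 x) (R_ne_top x), ← ENNReal.rpow_add _ _ (R_ne_zero h0 x) (R_ne_top x)]
    congr 1; ring
end

section prob
variable {θ : Measure (Od d)} [IsProbabilityMeasure θ] {P : Measure (Omega d m σm σp)} [IsProbabilityMeasure P]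

lemma pre_ne' {i j : ℕ → Fin m} {k l : ℕ} (h : k ≠ l) : pre i k ≠ pre j l := by
  intro he
  exact h (congrArg Sigma.fst he)

lemma measurable_node {g : Label d σm σp → ℝ≥0∞} (hg : Measurable g) (u : JW m) :
    Measurable fun ω : Omega d m σm σp => g (ω u) := hg.comp (measurable_pi_apply u)

lemma prodE (h : σm < σp) (hP : IsProductLaw θ P) (i : ℕ → Fin m) (g : ℕ → Label d σm σp → ℝ≥0∞)
    (hg : ∀ l, Measurable (g l)) (n : ℕ) :
    ∫⁻ ω, ∏ l ∈ Finset.range n, g l (ω (pre i l)) ∂P =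
      ∏ l ∈ Finset.range n, ∫⁻ x, g l x ∂(labelM σm σp θ) := by
  induction n with
  | zero => simp
  | succ n ih =>
    simp only [Finset.prod_range_succ]
    rw [factor h hP (pre i n) _ (Finset.measurable_prod _ fun l _ => measurable_node (hg l) _) _ _ (hg n), ih]
    intro ω x
    refine Finset.prod_congr rfl fun l hl => ?_
    rw [Function.update_of_ne (pre_ne' (by have := Finset.mem_range.1 hl; omega))]

lemma pairE (h : σm < σp) (hP : IsProductLaw θ P) (i j : ℕ → Fin m) {p b : ℕ} (hij : i p ≠ j p) (hb : p ≤ b)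
    (f : Omega d m σm σp → ℝ≥0∞) (hf : Measurable f)
    (hfi : ∀ ω l x, b ≤ l → f (Function.update ω (pre i l) x) = f ω)
    (hfj : ∀ ω l x, b ≤ l → f (Function.update ω (pre j l) x) = f ω)
    (g : ℕ → Label d σm σp → ℝ≥0∞)
    (hg : ∀ l, Measurable (g l)) (n : ℕ) :
    ∫⁻ ω, f ω * ∏ q ∈ Finset.range n, (g q (ω (pre i (b + q))) * g q (ω (pre j (b + q)))) ∂P =
      (∫⁻ ω, f ω ∂P) * ∏ q ∈ Finset.range n, (∫⁻ x, g q x ∂(labelM σm σp θ)) ^ 2 := by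
  induction n with
  | zero => simp
  | succ n ih =>
    simp only [Finset.prod_range_succ]
    have hpm : Measurable fun ω : Omega d m σm σp =>
        f ω * ∏ q ∈ Finset.range n, (g q (ω (pre i (b + q))) * g q (ω (pre j (b + q)))) :=
      hf.mul (Finset.measurable_prod _ fun l _ => (measurable_node (hg l) _).mul (measurable_node (hg l) _))
    have e : ∀ ω : Omega d m σm σp, f ω * ((∏ q ∈ Finset.range n, (g q (ω (pre i (b + q))) * g q (ω (pre j (b + q))))) *
        (g n (ω (pre i (b + n))) * g n (ω (pre j (b + n))))) =
        ((f ω * ∏ q ∈ Finset.range n, (g q (ω (pre i (b + q))) * g q (ω (pre j (b + q))))) *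
        g n (ω (pre i (b + n)))) * g n (ω (pre j (b + n))) := fun ω => by ring
    have hpm2 : Measurable fun ω : Omega d m σm σp =>
        (f ω * ∏ q ∈ Finset.range n, (g q (ω (pre i (b + q))) * g q (ω (pre j (b + q))))) * g n (ω (pre i (b + n))) :=
      hpm.mul (measurable_node (hg n) _)
    simp only [e]
    rw [factor h hP (pre j (b + n)) _ hpm2 _ _ (hg n),
      factor h hP (pre i (b + n)) _ hpm _ _ (hg n), ih]
    · ring
    · intro ω x
      rw [hfi _ _ _ (by omega)]
      congr 1
      refine Finset.prod_congr rfl fun l hl => ?_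
      have := Finset.mem_range.1 hl
      rw [Function.update_of_ne (pre_ne' (by omega)), Function.update_of_ne (pre_ne' (by omega))]
    · intro ω x
      rw [hfj _ _ _ (by omega), Function.update_of_ne (pre_ne hij (by omega))]
      congr 2
      refine Finset.prod_congr rfl fun l hl => ?_
      have := Finset.mem_range.1 hl
      rw [Function.update_of_ne (pre_ne' (by omega)), Function.update_of_ne (pre_ne' (by omega))]
end prob

lemma card_agree (n p : ℕ) (hp : p ≤ n) (w : Fin n → Fin m) :
    (Finset.univ.filter fun v : Fin n → Fin m => ∀ l : Fin n, l.1 < p → w l = v l).card ≤ m ^ (n - p) := by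
  have : Fintype.card (Fin (n - p) → Fin m) = m ^ (n - p) := by simp
  rw [← this, ← Finset.card_univ]
  refine Finset.card_le_card_of_injOn (fun v q => v ⟨p + q.1, by omega⟩) (fun _ _ => Finset.mem_univ _) ?_
  intro v hv v' hv' he
  simp only [Finset.coe_filter, Finset.mem_univ, true_and, Set.mem_setOf_eq] at hv hv'
  funext l
  by_cases hl : l.1 < p
  · rw [← hv l hl, hv' l hl]
  · have := congrFun he ⟨l.1 - p, by omega⟩
    simp only at this
    convert this using 2 <;> (ext; simp; omega)

lemma count (n : ℕ) (g : ℕ → ℝ≥0∞) (F : (Fin n → Fin m) → (Fin n → Fin m) → ℝ≥0∞)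
    (H : ∀ w v, ∃ p ≤ n, (∀ l : Fin n, l.1 < p → w l = v l) ∧ F w v ≤ g p) :
    ∑ w, ∑ v, F w v ≤ ∑ p ∈ Finset.range (n + 1), (m : ℝ≥0∞) ^ n * ((m : ℝ≥0∞) ^ (n - p) * g p) := by
  rw [← Finset.mul_sum]
  have : ∀ w, ∑ v, F w v ≤ ∑ p ∈ Finset.range (n + 1), ((m : ℝ≥0∞) ^ (n - p) * g p) := by
    intro w
    calc _ ≤ ∑ v : Fin n → Fin m, ∑ p ∈ Finset.range (n + 1), (if (∀ l : Fin n, l.1 < p → w l = v l) then g p else 0) := by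
          apply Finset.sum_le_sum
          intro v _
          obtain ⟨p, hp, hl, hF⟩ := H w v
          refine hF.trans ?_
          have := Finset.single_le_sum (f := fun p => (if (∀ l : Fin n, l.1 < p → w l = v l) then g p else 0))
            (fun _ _ => zero_le) (Finset.mem_range.2 (Nat.lt_succ_of_le hp))
          rwa [if_pos hl] at this
      _ = ∑ p ∈ Finset.range (n + 1), ∑ v : Fin n → Fin m, (if (∀ l : Fin n, l.1 < p → w l = v l) then g p else 0) :=
          Finset.sum_comm
      _ ≤ _ := by
          apply Finset.sum_le_sum
          intro p hp
          rw [← Finset.sum_filter, Finset.sum_const, nsmul_eq_mul]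
          refine mul_le_mul' ?_ le_rfl
          exact_mod_cast card_agree n p (by have := Finset.mem_range.1 hp; omega) w
  calc _ ≤ ∑ w : Fin n → Fin m, ∑ p ∈ Finset.range (n + 1), ((m : ℝ≥0∞) ^ (n - p) * g p) :=
        Finset.sum_le_sum fun w _ => this w
    _ = _ := by simp

end RSS
end

open MeasureTheory Filter Topology
open scoped ENNReal
noncomputable section
namespace RSS
variable {d m : ℕ} {σm σp : ℝ}

section prob
variable {θ : Measure (Od d)} [IsProbabilityMeasure θ] {P : Measure (Omega d m σm σp)} [IsProbabilityMeasure P]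

lemma half_key (h0 : 0 < σm) (h : σm < σp) (h1 : σp < 1) (hP : IsProductLaw θ P) (a : Fin m → E d)
    {t : ℝ} {δ : ℝ} {C : ℝ≥0∞}
    (hC : ∀ x y : E d, δ ≤ ‖x‖ → ∫⁻ l : Label d σm σp, ‖(l.1 : ℝ) • act d l.2 x - y‖ₑ ^ (-t) ∂(labelM σm σp θ) ≤ C)
    {i j : ℕ → Fin m} {p : ℕ} (hij : i p ≠ j p) (B : Omega d m σm σp → ℝ≥0∞) (hB : Measurable B)
    (hBi : ∀ ω x, B (Function.update ω (pre i p) x) = B ω) :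
    ∫⁻ ω, B ω * (if δ ≤ ‖tail a ω i (p + 1)‖ then ‖tail a ω i p - tail a ω j p‖ₑ ^ (-t) else 0) ∂P
      ≤ C * ∫⁻ ω, B ω ∂P := by
  have hmz : Measurable fun ω : Omega d m σm σp => ‖tail a ω i p - tail a ω j p‖ₑ ^ (-t) :=
    (((measurable_tail h0 h h1 a i p).sub (measurable_tail h0 h h1 a j p)).enorm).pow_const _
  have hms : MeasurableSet {ω : Omega d m σm σp | δ ≤ ‖tail a ω i (p + 1)‖} :=
    measurableSet_le measurable_const (measurable_tail h0 h h1 a i (p + 1)).norm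
  have hmt : Measurable fun ω : Omega d m σm σp => B ω *
      (if δ ≤ ‖tail a ω i (p + 1)‖ then ‖tail a ω i p - tail a ω j p‖ₑ ^ (-t) else 0) :=
    hB.mul (Measurable.ite hms hmz measurable_const)
  rw [lintegral_resample h hP (pre i p) _ hmt,
    ← lintegral_const_mul _ hB]
  apply lintegral_mono
  intro ω
  dsimp only
  have e1 : ∀ x, tail a (Function.update ω (pre i p) x) i (p + 1) = tail a ω i (p + 1) := by
    intro x
    refine tail_congr _ _ _ _ _ fun l hl => ?_
    rw [Function.update_of_ne (pre_ne' (by omega))]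
  have e2 : ∀ x, tail a (Function.update ω (pre i p) x) j p = tail a ω j p := by
    intro x
    refine tail_congr _ _ _ _ _ fun l hl => ?_
    by_cases hlp : l = p
    · subst hlp
      rw [Function.update_of_ne (pre_ne hij le_rfl).symm]
    · rw [Function.update_of_ne (pre_ne' hlp)]
  have e3 : ∀ x, tail a (Function.update ω (pre i p) x) i p =
      a (i p) + (x.1 : ℝ) • act d x.2 (tail a ω i (p + 1)) := by
    intro x
    rw [tail_rec h0 h h1, e1, Tnode, Function.update_self]
    rfl
  simp only [hBi, e1, e2, e3]
  split_ifs with hδ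
  · have hmm : Measurable fun x : Label d σm σp =>
        ‖a (i p) + (x.1 : ℝ) • act d x.2 (tail a ω i (p + 1)) - tail a ω j p‖ₑ ^ (-t) := by
      refine Measurable.pow_const (Measurable.enorm ?_) _
      refine Measurable.sub_const (Measurable.const_add ?_ _) _
      refine Measurable.smul (M := ℝ) (f := fun x : Label d σm σp => (x.1 : ℝ)) ?_ (measurable_act measurable_snd measurable_const)
      exact measurable_subtype_coe.comp measurable_fst
    rw [lintegral_const_mul _ hmm, mul_comm]
    refine mul_le_mul' ?_ le_rfl
    refine le_trans (le_of_eq ?_) (hC (tail a ω i (p + 1)) (tail a ω j p - a (i p)) hδ)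
    congr 1; funext x; congr 2; abel
  · simp

lemma exists_sep (a : Fin m → E d) (ha : Function.Injective a) :
    ∃ δ : ℝ, 0 < δ ∧ ∀ x y, x ≠ y → δ ≤ ‖a x - a y‖ := by
  classical
  by_cases hne : (Finset.univ.offDiag : Finset (Fin m × Fin m)).Nonempty
  · refine ⟨(Finset.univ.offDiag).inf' hne fun q => ‖a q.1 - a q.2‖, ?_, ?_⟩
    · rw [Finset.lt_inf'_iff]
      intro q hq
      rw [norm_pos_iff, sub_ne_zero]
      exact fun e => (Finset.mem_offDiag.1 hq).2.2 (ha e)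
    · intro x y hxy
      exact Finset.inf'_le (f := fun q : Fin m × Fin m => ‖a q.1 - a q.2‖) (b := (x, y)) (by simp [hxy])
  · refine ⟨1, one_pos, fun x y hxy => ?_⟩
    exact absurd ⟨(x, y), by simp [hxy]⟩ hne

end prob

lemma energy_key (hd : 1 ≤ d) (h0 : 0 < σm) (h : σm < σp) (h1 : σp < 1) (a : Fin m → E d)
    (ha : Function.Injective a) (θ : Measure (Od d)) [IsProbabilityMeasure θ] [θ.IsMulLeftInvariant]
    (P : Measure (Omega d m σm σp)) [IsProbabilityMeasure P] (hP : IsProductLaw θ P)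
    {t : ℝ} (ht0 : 0 < t) (ht : t < d) :
    ∃ C : ℝ≥0∞, C ≠ ⊤ ∧ ∀ (i j : ℕ → Fin m) (p : ℕ), i p ≠ j p →
      ∀ B : Omega d m σm σp → ℝ≥0∞, Measurable B →
      (∀ ω x, B (Function.update ω (pre i p) x) = B ω) → (∀ ω x, B (Function.update ω (pre j p) x) = B ω) →
      ∫⁻ ω, B ω * ‖tail a ω i p - tail a ω j p‖ₑ ^ (-t) ∂P ≤ C * ∫⁻ ω, B ω ∂P := by
  obtain ⟨δ, hδ, hsep⟩ := exists_sep a ha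
  obtain ⟨C, hCt, hC⟩ := label_bound hd h0 h θ (δ := δ / 3) (by positivity) ht ht0
  refine ⟨ENNReal.ofReal (δ / 3) ^ (-t) + C + C, ?_, ?_⟩
  · have : ENNReal.ofReal (δ / 3) ^ (-t) ≠ ⊤ := by
      rw [ENNReal.rpow_neg]
      refine ENNReal.inv_ne_top.2 ?_
      rw [Ne, ENNReal.rpow_eq_zero_iff_of_pos ht0, ENNReal.ofReal_eq_zero, not_le]
      positivity
    finiteness
  intro i j p hij B hB hBi hBj
  have A1 := half_key h0 h h1 hP a hC hij B hB hBi
  have A2 := half_key h0 h h1 hP a hC hij.symm B hB hBj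
  have hm1 : Measurable fun ω : Omega d m σm σp => B ω * ENNReal.ofReal (δ / 3) ^ (-t) := hB.mul_const _
  have hms : ∀ i : ℕ → Fin m, MeasurableSet {ω : Omega d m σm σp | δ / 3 ≤ ‖tail a ω i (p + 1)‖} := fun i =>
    measurableSet_le measurable_const (measurable_tail h0 h h1 a i (p + 1)).norm
  have hmz : ∀ i j : ℕ → Fin m, Measurable fun ω : Omega d m σm σp => ‖tail a ω i p - tail a ω j p‖ₑ ^ (-t) := fun i j =>
    (((measurable_tail h0 h h1 a i p).sub (measurable_tail h0 h h1 a j p)).enorm).pow_const _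
  have hm2 : Measurable fun ω : Omega d m σm σp => B ω *
      (if δ / 3 ≤ ‖tail a ω i (p + 1)‖ then ‖tail a ω i p - tail a ω j p‖ₑ ^ (-t) else 0) :=
    hB.mul (Measurable.ite (hms i) (hmz i j) measurable_const)
  have hm3 : Measurable fun ω : Omega d m σm σp => B ω *
      (if δ / 3 ≤ ‖tail a ω j (p + 1)‖ then ‖tail a ω j p - tail a ω i p‖ₑ ^ (-t) else 0) :=
    hB.mul (Measurable.ite (hms j) (hmz j i) measurable_const)
  calc _ ≤ ∫⁻ ω, (B ω * ENNReal.ofReal (δ / 3) ^ (-t) + B ω *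
      (if δ / 3 ≤ ‖tail a ω i (p + 1)‖ then ‖tail a ω i p - tail a ω j p‖ₑ ^ (-t) else 0) + B ω *
      (if δ / 3 ≤ ‖tail a ω j (p + 1)‖ then ‖tail a ω j p - tail a ω i p‖ₑ ^ (-t) else 0)) ∂P := by
        apply lintegral_mono
        intro ω
        dsimp only
        rw [← mul_add, ← mul_add]
        refine mul_le_mul' le_rfl ?_
        by_cases c1 : δ / 3 ≤ ‖tail a ω i (p + 1)‖
        · rw [if_pos c1]
          exact le_add_right (le_add_left le_rfl)
        by_cases c2 : δ / 3 ≤ ‖tail a ω j (p + 1)‖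
        · rw [if_pos c2, ← enorm_neg, neg_sub]
          exact le_add_left le_rfl
        rw [if_neg c1, if_neg c2, add_zero, add_zero, ENNReal.rpow_neg, ENNReal.rpow_neg]
        refine ENNReal.inv_le_inv.2 (ENNReal.rpow_le_rpow ?_ ht0.le)
        rw [← ofReal_norm]
        apply ENNReal.ofReal_le_ofReal
        rw [tail_rec h0 h h1 a ω i p, tail_rec h0 h h1 a ω j p]
        have b1 := hsep _ _ hij
        have n1 : ‖Tnode ω (pre i p) (tail a ω i (p + 1))‖ ≤ δ / 3 := by
          rw [norm_Tnode h0]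
          have := (ω (pre i p)).1.2.2.le
          have := (r_pos h0 (ω (pre i p))).le
          push Not at c1
          nlinarith [norm_nonneg (tail a ω i (p + 1))]
        have n2 : ‖Tnode ω (pre j p) (tail a ω j (p + 1))‖ ≤ δ / 3 := by
          rw [norm_Tnode h0]
          have := (ω (pre j p)).1.2.2.le
          have := (r_pos h0 (ω (pre j p))).le
          push Not at c2
          nlinarith [norm_nonneg (tail a ω j (p + 1))]
        set u := Tnode ω (pre i p) (tail a ω i (p + 1))
        set v := Tnode ω (pre j p) (tail a ω j (p + 1))
        have : a (i p) - a (j p) = (a (i p) + u - (a (j p) + v)) - u + v := by abel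
        rw [this] at b1
        have := norm_add_le ((a (i p) + u - (a (j p) + v)) - u) v
        have := norm_sub_le (a (i p) + u - (a (j p) + v)) u
        linarith
    _ = _ := by rw [lintegral_add_right _ hm3, lintegral_add_right _ hm2]
    _ ≤ ENNReal.ofReal (δ / 3) ^ (-t) * ∫⁻ ω, B ω ∂P + C * ∫⁻ ω, B ω ∂P + C * ∫⁻ ω, B ω ∂P := by
        refine add_le_add (add_le_add ?_ A1) A2
        rw [lintegral_mul_const _ hB, mul_comm]
    _ = _ := by ring

end RSS
end

open MeasureTheory Filter Topology
open scoped ENNReal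
noncomputable section
namespace RSS
variable {d m : ℕ} {σm σp : ℝ}

/-- extension of a finite word to an infinite one. -/
def wext (hm : 0 < m) {n : ℕ} (w : Fin n → Fin m) : ℕ → Fin m := fun l => if h : l < n then w ⟨l, h⟩ else ⟨0, hm⟩

lemma wext_apply (hm : 0 < m) {n : ℕ} (w : Fin n → Fin m) (l : Fin n) : wext hm w l.1 = w l := by
  simp [wext]

lemma wext_ge (hm : 0 < m) {n : ℕ} (w : Fin n → Fin m) {l : ℕ} (hl : n ≤ l) : wext hm w l = ⟨0, hm⟩ := by
  simp [wext, hl]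

lemma wext_diff (hm : 0 < m) {n : ℕ} {w v : Fin n → Fin m} (h : w ≠ v) :
    ∃ p < n, (∀ l : Fin n, l.1 < p → w l = v l) ∧ (∀ k < p, wext hm w k = wext hm v k) ∧ wext hm w p ≠ wext hm v p := by
  classical
  have hex : ∃ p, wext hm w p ≠ wext hm v p := by
    by_contra hc
    push Not at hc
    apply h
    funext l
    rw [← wext_apply hm w, hc, wext_apply]
  have hlt : Nat.find hex < n := by
    by_contra hc
    apply Nat.find_spec hex
    rw [wext_ge hm w (not_lt.1 hc), wext_ge hm v (not_lt.1 hc)]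
  have hk : ∀ k < Nat.find hex, wext hm w k = wext hm v k := fun k hk => by
    simpa using Nat.find_min hex hk
  refine ⟨_, hlt, fun l hl => ?_, hk, Nat.find_spec hex⟩
  rw [← wext_apply hm w, hk _ hl, wext_apply]

/-- product weights along a word. -/
def pw (m : ℕ) (s : ℝ) (k n : ℕ) (i : ℕ → Fin m) (ω : Omega d m σm σp) : ℝ≥0∞ :=
  ∏ l ∈ Finset.range n, wt m s k l (ω (pre i l))

lemma measurable_pw (s : ℝ) (k n : ℕ) (i : ℕ → Fin m) : Measurable (pw m s k n i : Omega d m σm σp → ℝ≥0∞) :=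
  Finset.measurable_prod _ fun l _ => measurable_node (measurable_wt s k l) _

lemma pw_le (h1 : σp < 1) {s : ℝ} (hs : 0 < s) (k n : ℕ) (i : ℕ → Fin m) (ω : Omega d m σm σp) :
    pw m s k n i ω ≤ (max (m : ℝ≥0∞)⁻¹ (ENNReal.ofReal σp ^ s)) ^ n := by
  unfold pw
  calc _ ≤ ∏ l ∈ Finset.range n, (max (m : ℝ≥0∞)⁻¹ (ENNReal.ofReal σp ^ s)) :=
        Finset.prod_le_prod' fun l _ => wt_le h1 hs k l _
    _ = _ := by simp

lemma pw_pair {s : ℝ} {i j : ℕ → Fin m} {p : ℕ} (hlt : ∀ l < p, i l = j l) (k N : ℕ) (ω : Omega d m σm σp) :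
    pw m s k (p + N) i ω * pw m s k (p + N) j ω =
      (∏ l ∈ Finset.range p, (wt m s k l (ω (pre i l)) * wt m s k l (ω (pre i l)))) *
      ∏ q ∈ Finset.range N, (wt m s k (p + q) (ω (pre i (p + q))) * wt m s k (p + q) (ω (pre j (p + q)))) := by
  unfold pw
  rw [← Finset.prod_mul_distrib, Finset.prod_range_add]
  congr 1
  refine Finset.prod_congr rfl fun l hl => ?_
  rw [pre_congr hlt (Finset.mem_range.1 hl)]

lemma prod_update (g : ℕ → Label d σm σp → ℝ≥0∞) (i j : ℕ → Fin m) (p l : ℕ) (hl : p ≤ l)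
    (ω : Omega d m σm σp) (x : Label d σm σp) :
    ∏ q ∈ Finset.range p, g q (Function.update ω (pre j l) x (pre i q)) =
      ∏ q ∈ Finset.range p, g q (ω (pre i q)) := by
  refine Finset.prod_congr rfl fun q hq => ?_
  have := Finset.mem_range.1 hq
  rw [Function.update_of_ne (pre_ne' (by omega))]

section prob
variable {θ : Measure (Od d)} [IsProbabilityMeasure θ] {P : Measure (Omega d m σm σp)} [IsProbabilityMeasure P]
  {s : ℝ}

lemma pw_int (h : σm < σp) (hP : IsProductLaw θ P)
    (hx : ∫⁻ l, R l ^ s ∂(labelM σm σp θ) = (m : ℝ≥0∞)⁻¹) (k n : ℕ) (i : ℕ → Fin m) :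
    ∫⁻ ω, pw m s k n i ω ∂P = (m : ℝ≥0∞)⁻¹ ^ n := by
  unfold pw
  rw [prodE h hP i _ (fun l => measurable_wt s k l)]
  simp [int_wt h hx]

lemma sq_prod (hm : 0 < m) (h0 : 0 < σm) (h : σm < σp) (hP : IsProductLaw θ P) (hs : 0 < s)
    (hx : ∫⁻ l, R l ^ s ∂(labelM σm σp θ) = (m : ℝ≥0∞)⁻¹) (k p : ℕ) (i : ℕ → Fin m) :
    ∫⁻ ω, ∏ l ∈ Finset.range p, (wt m s k l (ω (pre i l)) * wt m s k l (ω (pre i l))) ∂P ≤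
      (m : ℝ≥0∞)⁻¹ ^ (2 * p) * (ENNReal.ofReal σp ^ s * m) ^ (p - k) := by
  rw [prodE h hP i (fun l x => wt m s k l x * wt m s k l x) (fun l => (measurable_wt s k l).mul (measurable_wt s k l))]
  refine (Finset.prod_le_prod' fun l _ => int_wt_sq hm h0 h hs hx k l).trans (le_of_eq ?_)
  rw [Finset.prod_mul_distrib, prod_ite_range, one_pow, one_mul, Finset.prod_const, Finset.card_range, pow_mul]

lemma pair2 (hm : 0 < m) (h0 : 0 < σm) (h : σm < σp) (hP : IsProductLaw θ P) (hs : 0 < s)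
    (hx : ∫⁻ l, R l ^ s ∂(labelM σm σp θ) = (m : ℝ≥0∞)⁻¹) (k : ℕ) {p n : ℕ} (hp : p ≤ n) {i j : ℕ → Fin m}
    (hlt : ∀ l < p, i l = j l) (hne : i p ≠ j p) :
    ∫⁻ ω, pw m s k n i ω * pw m s k n j ω ∂P ≤
      (m : ℝ≥0∞)⁻¹ ^ (2 * n) * (ENNReal.ofReal σp ^ s * m) ^ (p - k) := by
  obtain ⟨N, rfl⟩ := Nat.exists_eq_add_of_le hp
  simp only [pw_pair hlt]
  have hfm : Measurable fun ω : Omega d m σm σp =>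
      ∏ l ∈ Finset.range p, (wt m s k l (ω (pre i l)) * wt m s k l (ω (pre i l))) :=
    Finset.measurable_prod _ fun l _ =>
      (measurable_node (measurable_wt s k l) _).mul (measurable_node (measurable_wt s k l) _)
  rw [pairE h hP i j hne le_rfl _ hfm
    (fun ω l x hl => prod_update (fun l x => wt m s k l x * wt m s k l x) i i p l hl ω x)
    (fun ω l x hl => prod_update (fun l x => wt m s k l x * wt m s k l x) i j p l hl ω x)
    (fun q => wt m s k (p + q)) (fun q => measurable_wt s k _)]
  refine (mul_le_mul' (sq_prod hm h0 h hP hs hx k p i) le_rfl).trans (le_of_eq ?_)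
  simp only [int_wt h hx, Finset.prod_const, Finset.card_range]
  rw [← pow_mul, mul_add, pow_add]
  ring

lemma edist_pi (h0 : 0 < σm) (h : σm < σp) (h1 : σp < 1) (a : Fin m → E d) (ω : Omega d m σm σp) {p : ℕ} {i j : ℕ → Fin m}
    (hlt : ∀ l < p, i l = j l) (t : ℝ) :
    edist (piMap a ω i) (piMap a ω j) ^ (-t) =
      (∏ l ∈ Finset.range p, R (ω (pre i l)) ^ (-t)) * ‖tail a ω i p - tail a ω j p‖ₑ ^ (-t) := by
  have e : edist (piMap a ω i) (piMap a ω j) = (∏ l ∈ Finset.range p, R (ω (pre i l))) * ‖tail a ω i p - tail a ω j p‖ₑ := by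
    rw [edist_eq_enorm_sub, pi_sub h0 h h1 a ω i j p hlt, ← ofReal_norm, norm_cT h0, ENNReal.ofReal_mul, ofReal_norm]
    · congr 1
      unfold cumR R
      rw [ENNReal.ofReal_prod_of_nonneg fun l _ => (r_pos h0 _).le]
    · exact Finset.prod_nonneg fun l _ => (r_pos h0 _).le
  have hne : (∏ l ∈ Finset.range p, R (ω (pre i l))) ≠ 0 := Finset.prod_ne_zero_iff.2 fun l _ => R_ne_zero h0 _
  have hnt : (∏ l ∈ Finset.range p, R (ω (pre i l))) ≠ ⊤ := ENNReal.prod_ne_top fun l _ => R_ne_top _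
  rw [e, ENNReal.mul_rpow_of_ne_top hnt (by simp)]
  congr 1
  have : ∀ S : Finset ℕ, (∏ l ∈ S, R (ω (pre i l))) ^ (-t) = ∏ l ∈ S, R (ω (pre i l)) ^ (-t) := by
    intro S
    induction S using Finset.induction_on with
    | empty => simp
    | insert b S hb ih =>
      rw [Finset.prod_insert hb, Finset.prod_insert hb, ← ih, ENNReal.mul_rpow_of_ne_top (R_ne_top _)]
      exact ENNReal.prod_ne_top fun l _ => R_ne_top _
  exact this _

lemma pairI (hm : 2 ≤ m) (h0 : 0 < σm) (h : σm < σp) (h1 : σp < 1) (hP : IsProductLaw θ P) (hs : 0 < s)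
    (hx : ∫⁻ l, R l ^ s ∂(labelM σm σp θ) = (m : ℝ≥0∞)⁻¹) (a : Fin m → E d) {t : ℝ} (ht0 : 0 < t) (ht : t < s)
    {C : ℝ≥0∞}
    (hC : ∀ (i j : ℕ → Fin m) (p : ℕ), i p ≠ j p →
      ∀ B : Omega d m σm σp → ℝ≥0∞, Measurable B →
      (∀ ω x, B (Function.update ω (pre i p) x) = B ω) → (∀ ω x, B (Function.update ω (pre j p) x) = B ω) →
      ∫⁻ ω, B ω * ‖tail a ω i p - tail a ω j p‖ₑ ^ (-t) ∂P ≤ C * ∫⁻ ω, B ω ∂P)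
    (k : ℕ) {p N : ℕ} {i j : ℕ → Fin m}
    (hlt : ∀ l < p, i l = j l) (hne : i p ≠ j p) :
    ∫⁻ ω, pw m s k (p + 1 + N) i ω * pw m s k (p + 1 + N) j ω * edist (piMap a ω i) (piMap a ω j) ^ (-t) ∂P ≤
      C * ((m : ℝ≥0∞)⁻¹ ^ (p + 2 * N) * ((ENNReal.ofReal σm ^ (-t)) ^ (min p k) * (ENNReal.ofReal σp ^ (s - t)) ^ (p - k))) := by
  set H : ℕ → Label d σm σp → ℝ≥0∞ := fun l x => wt m s k l x * wt m s k l x * R x ^ (-t) with hH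
  have hHm : ∀ l, Measurable (H l) := fun l =>
    ((measurable_wt s k l).mul (measurable_wt s k l)).mul (measurable_R.pow_const _)
  set B : Omega d m σm σp → ℝ≥0∞ := fun ω => (∏ l ∈ Finset.range p, H l (ω (pre i l))) *
    ∏ q ∈ Finset.range N, (wt m s k (p + 1 + q) (ω (pre i (p + 1 + q))) * wt m s k (p + 1 + q) (ω (pre j (p + 1 + q)))) with hB
  have hfm : Measurable fun ω : Omega d m σm σp => ∏ l ∈ Finset.range p, H l (ω (pre i l)) :=
    Finset.measurable_prod _ fun l _ => measurable_node (hHm l) _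
  have hBm : Measurable B := hfm.mul (Finset.measurable_prod _ fun l _ =>
      (measurable_node (measurable_wt s k _) _).mul (measurable_node (measurable_wt s k _) _))
  have hBu : ∀ (i' : ℕ → Fin m) ω x, B (Function.update ω (pre i' p) x) = B ω := by
    intro i' ω x
    simp only [hB]
    rw [prod_update H i i' p p le_rfl]
    congr 1
    refine Finset.prod_congr rfl fun l hl => ?_
    rw [Function.update_of_ne (pre_ne' (by omega)), Function.update_of_ne (pre_ne' (by omega))]
  have wt1 : ∀ l (x : Label d σm σp), wt m s k l x ≤ 1 := fun l x => (wt_le h1 hs k l x).trans (q_lt hm h1 hs).le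
  calc _ ≤ ∫⁻ ω, B ω * ‖tail a ω i p - tail a ω j p‖ₑ ^ (-t) ∂P := by
        apply lintegral_mono
        intro ω
        dsimp only
        rw [edist_pi h0 h h1 a ω hlt, ← mul_assoc]
        refine mul_le_mul' ?_ le_rfl
        rw [show p + 1 + N = p + (N + 1) by ring, pw_pair hlt, Finset.prod_range_succ', hB]
        simp only [hH, Finset.prod_mul_distrib (s := Finset.range p)]
        rw [mul_right_comm]
        refine mul_le_mul' le_rfl ?_
        refine le_trans (mul_le_of_le_one_right' (mul_le_one' (wt1 _ _) (wt1 _ _))) (le_of_eq ?_)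
        refine Finset.prod_congr rfl fun q _ => ?_
        rw [show p + (q + 1) = p + 1 + q by ring]
    _ ≤ C * ∫⁻ ω, B ω ∂P := hC i j p hne B hBm (hBu i) (hBu j)
    _ ≤ _ := by
        refine mul_le_mul' le_rfl ?_
        rw [hB, pairE h hP i j hne (Nat.le_succ p) _ hfm
          (fun ω l x hl => prod_update H i i p l (by omega) ω x)
          (fun ω l x hl => prod_update H i j p l (by omega) ω x)
          (fun q => wt m s k (p + 1 + q)) (fun q => measurable_wt s k _), prodE h hP i H hHm]
        simp only [int_wt h hx, Finset.prod_const, Finset.card_range]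
        refine (mul_le_mul' (Finset.prod_le_prod' fun l _ => int_wt_en (by omega) h0 h ht0 ht hx k l) le_rfl).trans (le_of_eq ?_)
        rw [Finset.prod_mul_distrib, prod_ite_range, Finset.prod_const, Finset.card_range, pow_add, pow_mul]
        ring
end prob
end RSS
end

open MeasureTheory Filter Topology
open scoped ENNReal
noncomputable section
namespace RSS
variable {d m : ℕ} {σm σp : ℝ}

lemma geo1 (γ : ℝ≥0∞) (k N : ℕ) :
    ∑ p ∈ Finset.range N, (if k ≤ p then γ ^ (p - k) else 0) ≤ (1 - γ)⁻¹ := by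
  calc _ ≤ ∑ p ∈ Finset.range (k + N), (if k ≤ p then γ ^ (p - k) else 0) :=
        Finset.sum_le_sum_of_subset (Finset.range_mono (by omega))
    _ = ∑ p ∈ Finset.range N, γ ^ p := by
        rw [Finset.sum_range_add, Finset.sum_eq_zero, zero_add]
        · simp
        · intro p hp
          rw [if_neg (by have := Finset.mem_range.1 hp; omega)]
    _ ≤ _ := by
        rw [← ENNReal.tsum_geometric]
        exact ENNReal.sum_le_tsum _

lemma geo2 (γ : ℝ≥0∞) (k N : ℕ) :
    ∑ p ∈ Finset.range N, γ ^ (p - k) ≤ k + (1 - γ)⁻¹ := by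
  calc _ ≤ ∑ p ∈ Finset.range (k + N), γ ^ (p - k) :=
        Finset.sum_le_sum_of_subset (Finset.range_mono (by omega))
    _ = k + ∑ p ∈ Finset.range N, γ ^ p := by
        rw [Finset.sum_range_add]
        congr 1
        · rw [Finset.sum_congr rfl (g := fun _ => 1)]
          · simp
          · intro p hp
            rw [show p - k = 0 by have := Finset.mem_range.1 hp; omega, pow_zero]
        · simp
    _ ≤ _ := by
        rw [← ENNReal.tsum_geometric]
        gcongr
        exact ENNReal.sum_le_tsum _

/-- total mass. -/
def Mn (hm : 0 < m) (s : ℝ) (k n : ℕ) (ω : Omega d m σm σp) : ℝ≥0∞ :=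
  ∑ w : Fin n → Fin m, pw m s k n (wext hm w) ω

/-- off-diagonal energy. -/
def In (hm : 0 < m) (a : Fin m → E d) (s t : ℝ) (k n : ℕ) (ω : Omega d m σm σp) : ℝ≥0∞ :=
  ∑ w : Fin n → Fin m, ∑ v : Fin n → Fin m, if w = v then 0 else
    pw m s k n (wext hm w) ω * pw m s k n (wext hm v) ω *
      edist (piMap a ω (wext hm w)) (piMap a ω (wext hm v)) ^ (-t)

lemma measurable_Mn (hm : 0 < m) (s : ℝ) (k n : ℕ) : Measurable (Mn hm s k n : Omega d m σm σp → ℝ≥0∞) :=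
  Finset.measurable_sum _ fun _ _ => measurable_pw _ _ _ _

lemma measurable_In_term (hm : 0 < m) (h0 : 0 < σm) (h : σm < σp) (h1 : σp < 1) (a : Fin m → E d) (s t : ℝ) (k n : ℕ)
    (w v : Fin n → Fin m) :
    Measurable fun ω : Omega d m σm σp => if w = v then 0 else
    pw m s k n (wext hm w) ω * pw m s k n (wext hm v) ω *
      edist (piMap a ω (wext hm w)) (piMap a ω (wext hm v)) ^ (-t) := by
  split_ifs
  · exact measurable_const
  · simp only [piMap_eq]
    exact ((measurable_pw _ _ _ _).mul (measurable_pw _ _ _ _)).mul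
      (((measurable_tail h0 h h1 a _ _).edist (measurable_tail h0 h h1 a _ _)).pow_const _)

lemma measurable_In (hm : 0 < m) (h0 : 0 < σm) (h : σm < σp) (h1 : σp < 1) (a : Fin m → E d) (s t : ℝ) (k n : ℕ) :
    Measurable (In hm a s t k n : Omega d m σm σp → ℝ≥0∞) :=
  Finset.measurable_sum _ fun w _ => Finset.measurable_sum _ fun v _ => measurable_In_term hm h0 h h1 a s t k n w v

section prob
variable {θ : Measure (Od d)} [IsProbabilityMeasure θ] {P : Measure (Omega d m σm σp)} [IsProbabilityMeasure P]
  {s : ℝ}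

lemma mx (hm : 0 < m) : (m : ℝ≥0∞) * (m : ℝ≥0∞)⁻¹ = 1 :=
  ENNReal.mul_inv_cancel (by exact_mod_cast hm.ne') (by simp)

lemma EM (hm : 0 < m) (h : σm < σp) (hP : IsProductLaw θ P)
    (hx : ∫⁻ l, R l ^ s ∂(labelM σm σp θ) = (m : ℝ≥0∞)⁻¹) (k n : ℕ) :
    ∫⁻ ω, Mn hm s k n ω ∂P = 1 := by
  unfold Mn
  rw [lintegral_finsetSum _ fun w _ => measurable_pw _ _ _ _]
  simp only [pw_int h hP hx]
  simp only [Finset.sum_const, Finset.card_univ, nsmul_eq_mul, Fintype.card_pi, Fintype.card_fin, Finset.prod_const]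
  push_cast
  rw [← mul_pow, mx hm, one_pow]

lemma EM2 (hm : 0 < m) (h0 : 0 < σm) (h : σm < σp) (hP : IsProductLaw θ P) (hs : 0 < s)
    (hx : ∫⁻ l, R l ^ s ∂(labelM σm σp θ) = (m : ℝ≥0∞)⁻¹) (k n : ℕ) :
    ∫⁻ ω, Mn hm s k n ω ^ 2 ∂P ≤ 1 + (m : ℝ≥0∞)⁻¹ ^ k * (1 - ENNReal.ofReal σp ^ s)⁻¹ := by
  set γ := ENNReal.ofReal σp ^ s with hγ
  set x := (m : ℝ≥0∞)⁻¹ with hxd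
  set F : (Fin n → Fin m) → (Fin n → Fin m) → ℝ≥0∞ := fun w v =>
    ∫⁻ ω, pw m s k n (wext hm w) ω * pw m s k n (wext hm v) ω ∂P with hF
  have e1 : ∫⁻ ω, Mn hm s k n ω ^ 2 ∂P = ∑ w, ∑ v, F w v := by
    unfold Mn
    simp only [sq, Finset.sum_mul_sum]
    rw [lintegral_finsetSum _ fun w _ => Finset.measurable_sum _ fun v _ => by
      exact (measurable_pw s k n (wext hm w)).mul (measurable_pw s k n (wext hm v))]
    refine Finset.sum_congr rfl fun w _ => ?_
    rw [lintegral_finsetSum _ fun v _ => by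
      exact (measurable_pw s k n (wext hm w)).mul (measurable_pw s k n (wext hm v))]
  have e2 : ∀ w v, ∃ p ≤ n, (∀ l : Fin n, l.1 < p → w l = v l) ∧ F w v ≤ x ^ (2 * n) * (γ * m) ^ (p - k) := by
    intro w v
    by_cases hwv : w = v
    · subst hwv
      refine ⟨n, le_rfl, fun _ _ => rfl, ?_⟩
      refine le_trans (le_of_eq ?_) (sq_prod hm h0 h hP hs hx k n (wext hm w))
      simp only [hF, pw, Finset.prod_mul_distrib]
    · obtain ⟨p, hp, hl, hlt, hne⟩ := wext_diff hm hwv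
      exact ⟨p, hp.le, hl, pair2 hm h0 h hP hs hx k hp.le hlt hne⟩
  have e3 := count n (fun p => if k ≤ p then x ^ (2 * n) * (γ * m) ^ (p - k) else 0) (fun w v => F w v - x ^ (2 * n)) (by
    intro w v
    obtain ⟨p, hp, hl, hb⟩ := e2 w v
    refine ⟨p, hp, hl, ?_⟩
    rw [tsub_le_iff_left]
    split_ifs with hk
    · exact hb.trans (le_add_left le_rfl)
    · rw [show p - k = 0 by omega, pow_zero, mul_one] at hb
      exact hb.trans (le_add_right le_rfl))
  rw [e1]
  calc _ ≤ ∑ w, ∑ v, (x ^ (2 * n) + (F w v - x ^ (2 * n))) := by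
        gcongr
        exact le_add_tsub
    _ = 1 + ∑ w, ∑ v, (F w v - x ^ (2 * n)) := by
        simp only [Finset.sum_add_distrib]
        congr 1
        simp only [Finset.sum_const, Finset.card_univ, nsmul_eq_mul, Fintype.card_pi, Fintype.card_fin, Finset.prod_const]
        push_cast
        calc _ = ((m : ℝ≥0∞) * x) ^ (2 * n) := by ring
          _ = _ := by rw [hxd, mx hm, one_pow]
    _ ≤ 1 + ∑ p ∈ Finset.range (n + 1), x ^ k * (if k ≤ p then γ ^ (p - k) else 0) := by
        refine add_le_add le_rfl (e3.trans (le_of_eq ?_))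
        refine Finset.sum_congr rfl fun p hp => ?_
        split_ifs with hk
        · obtain ⟨e, rfl⟩ := Nat.exists_eq_add_of_le hk
          obtain ⟨c, rfl⟩ := Nat.exists_eq_add_of_le (Nat.lt_succ_iff.1 (Finset.mem_range.1 hp))
          rw [show k + e + c - (k + e) = c by omega, show k + e - k = e by omega]
          calc _ = ((m : ℝ≥0∞) * x) ^ (k + 2 * e + 2 * c) * (x ^ k * γ ^ e) := by ring
            _ = _ := by rw [hxd, mx hm, one_pow, one_mul]
        · simp
    _ ≤ _ := by
        rw [← Finset.mul_sum]
        gcongr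
        exact geo1 _ _ _

lemma EI (hm : 2 ≤ m) (h0 : 0 < σm) (h : σm < σp) (h1 : σp < 1) (hP : IsProductLaw θ P) (hs : 0 < s)
    (hx : ∫⁻ l, R l ^ s ∂(labelM σm σp θ) = (m : ℝ≥0∞)⁻¹) (a : Fin m → E d) {t : ℝ} (ht0 : 0 < t) (ht : t < s)
    {C : ℝ≥0∞}
    (hC : ∀ (i j : ℕ → Fin m) (p : ℕ), i p ≠ j p →
      ∀ B : Omega d m σm σp → ℝ≥0∞, Measurable B →
      (∀ ω x, B (Function.update ω (pre i p) x) = B ω) → (∀ ω x, B (Function.update ω (pre j p) x) = B ω) →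
      ∫⁻ ω, B ω * ‖tail a ω i p - tail a ω j p‖ₑ ^ (-t) ∂P ≤ C * ∫⁻ ω, B ω ∂P)
    (k n : ℕ) :
    ∫⁻ ω, In (by omega : 0 < m) a s t k n ω ∂P ≤
      C * m ^ 2 * (ENNReal.ofReal σm ^ (-t)) ^ k * (k + (1 - ENNReal.ofReal σp ^ (s - t))⁻¹) := by
  have hm0 : 0 < m := by omega
  set A := ENNReal.ofReal σm ^ (-t) with hA
  have hA1 : 1 ≤ A := by
    rw [hA, ENNReal.rpow_neg, ENNReal.one_le_inv]
    exact ENNReal.rpow_le_one (by simpa using (h.trans h1).le) ht0.le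
  set γ := ENNReal.ofReal σp ^ (s - t) with hγ
  set x := (m : ℝ≥0∞)⁻¹ with hxd
  set F : (Fin n → Fin m) → (Fin n → Fin m) → ℝ≥0∞ := fun w v =>
    ∫⁻ ω, (if w = v then 0 else
      pw m s k n (wext hm0 w) ω * pw m s k n (wext hm0 v) ω *
      edist (piMap a ω (wext hm0 w)) (piMap a ω (wext hm0 v)) ^ (-t)) ∂P with hF
  have e1 : ∫⁻ ω, In (by omega : 0 < m) a s t k n ω ∂P = ∑ w, ∑ v, F w v := by
    unfold In
    rw [lintegral_finsetSum _ fun w _ => Finset.measurable_sum _ fun v _ => measurable_In_term hm0 h0 h h1 a s t k n w v]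
    refine Finset.sum_congr rfl fun w _ => ?_
    rw [lintegral_finsetSum _ fun v _ => measurable_In_term hm0 h0 h h1 a s t k n w v]
  have e3 := count n (fun p => if p < n then C * (x ^ (p + 2 * (n - (p + 1))) * (A ^ (min p k) * γ ^ (p - k))) else 0) F (by
    intro w v
    by_cases hwv : w = v
    · refine ⟨n, le_rfl, fun _ _ => by rw [hwv], ?_⟩
      simp [hF, hwv]
    · obtain ⟨p, hp, hl, hlt, hne⟩ := wext_diff hm0 hwv
      refine ⟨p, hp.le, hl, ?_⟩
      obtain ⟨N, rfl⟩ := Nat.exists_eq_add_of_le (Nat.succ_le_of_lt hp)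
      simp only [hF, if_neg hwv, if_pos hp]
      have := pairI hm h0 h h1 hP hs hx a ht0 ht hC k (N := N) hlt hne
      rwa [show p.succ + N - (p + 1) = N by omega])
  rw [e1]
  refine e3.trans ?_
  calc _ ≤ ∑ p ∈ Finset.range (n + 1), C * m ^ 2 * A ^ k * γ ^ (p - k) := by
        refine Finset.sum_le_sum fun p hp => ?_
        split_ifs with hpn
        · obtain ⟨N, rfl⟩ := Nat.exists_eq_add_of_le (Nat.succ_le_of_lt hpn)
          rw [show p.succ + N - (p + 1) = N by omega, show p.succ + N - p = N + 1 by omega]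
          calc _ = ((m : ℝ≥0∞) * x) ^ (p + 2 * N) * (C * m ^ 2 * A ^ (min p k) * γ ^ (p - k)) := by
                rw [Nat.succ_eq_add_one]; ring
            _ ≤ _ := by
                rw [hxd, mx hm0, one_pow, one_mul]
                gcongr
                exact min_le_right _ _
        · simp
    _ ≤ _ := by
        rw [← Finset.mul_sum]
        gcongr
        exact geo2 _ _ _

lemma cheb_pt (M : ℝ≥0∞) (hM : ¬ (2⁻¹ ≤ M ∧ M ≤ 2)) : 2 * M + 4⁻¹ ≤ M ^ 2 + 1 := by
  rcases eq_or_ne M ⊤ with rfl | hne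
  · simp
  lift M to NNReal using hne
  have h2 : (2⁻¹ : ℝ≥0∞) = ((2⁻¹ : NNReal) : ℝ≥0∞) := by simp
  have h4 : (4⁻¹ : ℝ≥0∞) = ((4⁻¹ : NNReal) : ℝ≥0∞) := by simp
  rw [h2] at hM
  rw [h4]
  norm_cast at hM ⊢
  rw [← NNReal.coe_le_coe]
  rw [← NNReal.coe_le_coe, ← NNReal.coe_le_coe] at hM
  push_cast at hM ⊢
  by_cases c : (2 : ℝ)⁻¹ ≤ M
  · have : (2 : ℝ) < M := by
      by_contra hc
      exact hM ⟨c, not_lt.1 hc⟩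
    nlinarith
  · push Not at c
    nlinarith

lemma cheb_pt' (M : ℝ≥0∞) : 2 * M ≤ M ^ 2 + 1 := by
  rcases eq_or_ne M ⊤ with rfl | hne
  · simp
  lift M to NNReal using hne
  norm_cast
  rw [← NNReal.coe_le_coe]
  push_cast
  nlinarith [sq_nonneg ((M : ℝ) - 1)]

lemma cheb {f : Omega d m σm σp → ℝ≥0∞} (hf : Measurable f) (h1 : ∫⁻ ω, f ω ∂P = 1) {y : ℝ≥0∞}
    (h2 : ∫⁻ ω, f ω ^ 2 ∂P ≤ 1 + y) : P {ω | ¬ (2⁻¹ ≤ f ω ∧ f ω ≤ 2)} ≤ 4 * y := by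
  have hms : MeasurableSet {ω | ¬ (2⁻¹ ≤ f ω ∧ f ω ≤ 2)} :=
    ((measurableSet_le measurable_const hf).inter (measurableSet_le hf measurable_const)).compl
  have key : ∫⁻ ω, (2 * f ω + Set.indicator {ω | ¬ (2⁻¹ ≤ f ω ∧ f ω ≤ 2)} (fun _ => (4⁻¹ : ℝ≥0∞)) ω) ∂P ≤
      ∫⁻ ω, (f ω ^ 2 + 1) ∂P := by
    apply lintegral_mono
    intro ω
    dsimp only
    by_cases hω : ω ∈ {ω | ¬ (2⁻¹ ≤ f ω ∧ f ω ≤ 2)}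
    · rw [Set.indicator_of_mem hω]
      exact cheb_pt _ hω
    · rw [Set.indicator_of_notMem hω, add_zero]
      exact cheb_pt' _
  rw [lintegral_add_left (hf.const_mul 2), lintegral_const_mul _ hf, h1, lintegral_indicator_const hms,
    lintegral_add_right _ measurable_const] at key
  have k2 : (2 : ℝ≥0∞) + 4⁻¹ * P {ω | ¬ (2⁻¹ ≤ f ω ∧ f ω ≤ 2)} ≤ 2 + y := by
    refine le_trans (le_of_eq (by simp)) (key.trans ?_)
    rw [lintegral_const, measure_univ, mul_one]
    refine (add_le_add h2 le_rfl).trans (le_of_eq ?_)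
    rw [add_right_comm, one_add_one_eq_two]
  rw [ENNReal.add_le_add_iff_left (by simp)] at k2
  calc _ = 4 * (4⁻¹ * P {ω | ¬ (2⁻¹ ≤ f ω ∧ f ω ≤ 2)}) := by
        rw [← mul_assoc, ENNReal.mul_inv_cancel (by simp) (by simp), one_mul]
    _ ≤ _ := by gcongr

end prob
end RSS
end

open MeasureTheory Filter Topology
open scoped ENNReal
noncomputable section
namespace RSS
variable {d m : ℕ} {σm σp : ℝ}
section prob
variable {θ : Measure (Od d)} [IsProbabilityMeasure θ] {P : Measure (Omega d m σm σp)} [IsProbabilityMeasure P]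
  {s : ℝ}

lemma good_prob (hd : 1 ≤ d) (hm : 2 ≤ m) (h0 : 0 < σm) (h : σm < σp) (h1 : σp < 1) [θ.IsMulLeftInvariant]
    (hP : IsProductLaw θ P) (hs : 0 < s)
    (hx : ∫⁻ l, R l ^ s ∂(labelM σm σp θ) = (m : ℝ≥0∞)⁻¹) (a : Fin m → E d) (ha : Function.Injective a)
    {t : ℝ} (ht0 : 0 < t) (ht : t < s) (htd : t < d) {η : ℝ≥0∞} (hη : η ≠ 0) (hηt : η ≠ ⊤) :
    ∃ (k : ℕ) (K : ℝ≥0∞), K ≠ ⊤ ∧ ∀ n, P {ω | ¬ ((2⁻¹ ≤ Mn (by omega : 0 < m) s k n ω ∧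
      Mn (by omega : 0 < m) s k n ω ≤ 2) ∧ In (by omega : 0 < m) a s t k n ω ≤ K)} ≤ η := by
  have hm0 : 0 < m := by omega
  obtain ⟨C, hCt, hC⟩ := energy_key hd h0 h h1 a ha θ P hP ht0 htd
  have hη2 : η / 2 ≠ 0 := (ENNReal.half_pos hη).ne'
  have hη2t : η / 2 ≠ ⊤ := by finiteness
  have hx1 : (m : ℝ≥0∞)⁻¹ < 1 := (le_max_left _ _).trans_lt (q_lt hm h1 hs)
  have hinv : ∀ u : ℝ, 0 < u → (1 - ENNReal.ofReal σp ^ u)⁻¹ ≠ ⊤ := by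
    intro u hu
    exact ENNReal.inv_ne_top.2 (tsub_pos_of_lt (S_pow_lt h1 hu)).ne'
  have hlim : Tendsto (fun k : ℕ => 4 * ((m : ℝ≥0∞)⁻¹ ^ k * (1 - ENNReal.ofReal σp ^ s)⁻¹)) atTop (𝓝 0) := by
    have := ENNReal.Tendsto.const_mul (a := 4) (ENNReal.Tendsto.mul_const
      (ENNReal.tendsto_pow_atTop_nhds_zero_of_lt_one hx1) (Or.inr (hinv s hs))) (Or.inr (by simp))
    simpa using this
  obtain ⟨k, hk⟩ := (hlim.eventually (ge_mem_nhds (pos_iff_ne_zero.2 hη2))).exists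
  set D : ℝ≥0∞ := C * m ^ 2 * (ENNReal.ofReal σm ^ (-t)) ^ k * (k + (1 - ENNReal.ofReal σp ^ (s - t))⁻¹) with hD
  have hDt : D ≠ ⊤ := by
    have e1 := hinv (s - t) (by linarith)
    have e2 : ENNReal.ofReal σm ^ (-t) ≠ ⊤ := by
      rw [ENNReal.rpow_neg]
      refine ENNReal.inv_ne_top.2 ?_
      rw [Ne, ENNReal.rpow_eq_zero_iff_of_pos ht0, ENNReal.ofReal_eq_zero, not_le]
      exact h0
    rw [hD]
    finiteness
  have hDe : ∀ n, ∫⁻ ω, In hm0 a s t k n ω ∂P ≤ D := fun n => EI hm h0 h h1 hP hs hx a ht0 ht hC k n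
  refine ⟨k, (D + 1) / (η / 2), ENNReal.div_ne_top (by finiteness) hη2, fun n => ?_⟩
  set K := (D + 1) / (η / 2) with hK
  have hKt : K ≠ ⊤ := ENNReal.div_ne_top (by finiteness) hη2
  have hK0 : K ≠ 0 := by
    rw [hK]
    exact (ENNReal.div_pos (by simp) hη2t).ne'
  have b1 := cheb (measurable_Mn hm0 s k n) (EM hm0 h hP hx k n) (EM2 hm0 h0 h hP hs hx k n)
  have b2 : P {ω | K ≤ In hm0 a s t k n ω} ≤ η / 2 := by
    refine (meas_ge_le_lintegral_div (measurable_In hm0 h0 h h1 a s t k n).aemeasurable hK0 hKt).trans ?_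
    apply ENNReal.div_le_of_le_mul
    rw [hK, ENNReal.mul_div_cancel hη2 hη2t]
    exact (hDe n).trans (le_add_right le_rfl)
  calc _ ≤ P ({ω | ¬ (2⁻¹ ≤ Mn hm0 s k n ω ∧ Mn hm0 s k n ω ≤ 2)} ∪ {ω | K ≤ In hm0 a s t k n ω}) := by
        apply measure_mono
        intro ω hω
        by_contra hc
        rw [Set.mem_union, not_or] at hc
        apply hω
        simp only [Set.mem_setOf_eq, not_not, not_le] at hc
        exact ⟨hc.1, hc.2.le⟩
    _ ≤ η / 2 + η / 2 := (measure_union_le _ _).trans (add_le_add (b1.trans hk) b2)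
    _ = η := ENNReal.add_halves η

lemma lower (hd : 1 ≤ d) (hm : 2 ≤ m) (h0 : 0 < σm) (h : σm < σp) (h1 : σp < 1) [θ.IsMulLeftInvariant]
    (hP : IsProductLaw θ P) (hs : 0 < s)
    (hx : ∫⁻ l, R l ^ s ∂(labelM σm σp θ) = (m : ℝ≥0∞)⁻¹) (a : Fin m → E d) (ha : Function.Injective a)
    {t : ℝ} (ht0 : 0 < t) (ht : t < s) (htd : t < d) :
    ∀ᵐ ω ∂P, ENNReal.ofReal t ≤ dimH (Fset a ω) := by
  have hm0 : 0 < m := by omega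
  have hN : P {ω | Measure.hausdorffMeasure t (Fset a ω) = 0} = 0 := by
    refine le_antisymm ?_ zero_le
    refine ENNReal.le_of_forall_pos_le_add fun η hη _ => ?_
    rw [zero_add]
    obtain ⟨k, K, hKt, hb⟩ := good_prob (P := P) hd hm h0 h h1 hP hs hx a ha ht0 ht htd
      (η := η) (by simpa using hη.ne') (by simp)
    set Bad : ℕ → Set (Omega d m σm σp) := fun n => {ω | ¬ ((2⁻¹ ≤ Mn hm0 s k n ω ∧
      Mn hm0 s k n ω ≤ 2) ∧ In hm0 a s t k n ω ≤ K)} with hBad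
    have hsub : {ω | Measure.hausdorffMeasure t (Fset a ω) = 0} ⊆ ⋃ N, ⋂ n ≥ N, Bad n := by
      intro ω hω
      by_contra hc
      simp only [Set.mem_iUnion, Set.mem_iInter, not_exists, not_forall] at hc
      refine haus_ne_zero (isCompact_F h0 h h1 a ω) ht0 hKt ?_ hω
      intro ε hε
      have hlim := ENNReal.tendsto_pow_atTop_nhds_zero_of_lt_one (q_lt (σp := σp) hm h1 hs)
      obtain ⟨N, hN⟩ := eventually_atTop.1 (hlim.eventually (ge_mem_nhds (pos_iff_ne_zero.2 hε)))
      obtain ⟨n, hn, hg⟩ := hc N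
      simp only [hBad, Set.mem_setOf_eq, not_not] at hg
      exact ⟨Fin n → Fin m, inferInstance, inferInstance, fun w => piMap a ω (wext hm0 w),
        fun w => pw m s k n (wext hm0 w) ω, fun w => ⟨_, rfl⟩, hg.1.1, hg.1.2,
        fun w => (pw_le h1 hs k n _ ω).trans (hN n hn), hg.2⟩
    refine (measure_mono hsub).trans ?_
    rw [Monotone.measure_iUnion]
    · refine iSup_le fun N => (measure_mono ?_).trans (hb N)
      exact Set.iInter₂_subset N le_rfl
    · intro N N' hNN
      exact Set.biInter_subset_biInter_left fun n hn => le_trans hNN hn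
  have : ∀ᵐ ω ∂P, ¬ Measure.hausdorffMeasure t (Fset a ω) = 0 := by
    rw [ae_iff]; simpa using hN
  filter_upwards [this] with ω hω
  have := le_dimH_of_hausdorffMeasure_ne_zero (d := t.toNNReal) (s := Fset a ω) (by
    rwa [Real.coe_toNNReal _ ht0.le])
  exact this

end prob
end RSS
end

open MeasureTheory Filter Topology
open scoped ENNReal
noncomputable section
namespace RSS
variable {d m : ℕ} {σm σp : ℝ}
section prob
variable {θ : Measure (Od d)} [IsProbabilityMeasure θ] {P : Measure (Omega d m σm σp)} [IsProbabilityMeasure P]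
  {s : ℝ}

lemma edist_bd (h0 : 0 < σm) (h : σm < σp) (h1 : σp < 1) (a : Fin m → E d) (ω : Omega d m σm σp) {p : ℕ}
    {i j : ℕ → Fin m} (hlt : ∀ l < p, i l = j l) :
    edist (piMap a ω i) (piMap a ω j) ≤
      (∏ l ∈ Finset.range p, R (ω (pre i l))) * ENNReal.ofReal (2 * (amax a * (1 - σp)⁻¹)) := by
  have := edist_pi h0 h h1 a ω hlt (-1)
  simp only [neg_neg, ENNReal.rpow_one] at this
  rw [this, ← ofReal_norm]
  refine mul_le_mul' le_rfl (ENNReal.ofReal_le_ofReal ?_)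
  have := norm_sub_le (tail a ω i p) (tail a ω j p)
  have := norm_tail_le h0 h h1 a ω i p
  have := norm_tail_le h0 h h1 a ω j p
  linarith

/-- covering sums. -/
def Sn (hm : 0 < m) (t : ℝ) (n : ℕ) (ω : Omega d m σm σp) : ℝ≥0∞ :=
  ∑ w : Fin n → Fin m, ∏ l ∈ Finset.range n, R (ω (pre (wext hm w) l)) ^ t

lemma measurable_Sn (hm : 0 < m) (t : ℝ) (n : ℕ) : Measurable (Sn hm t n : Omega d m σm σp → ℝ≥0∞) :=
  Finset.measurable_sum _ fun w _ => Finset.measurable_prod _ fun l _ => measurable_node (measurable_R.pow_const t) _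

lemma ESn (hm : 0 < m) (h0 : 0 < σm) (h : σm < σp) (hP : IsProductLaw θ P)
    (hx : ∫⁻ l, R l ^ s ∂(labelM σm σp θ) = (m : ℝ≥0∞)⁻¹) {u : ℝ} (hu : 0 ≤ u) (n : ℕ) :
    ∫⁻ ω, Sn hm (s + u) n ω ∂P ≤ (ENNReal.ofReal σp ^ u) ^ n := by
  unfold Sn
  rw [lintegral_finsetSum _ fun w _ => Finset.measurable_prod _ fun l _ => measurable_node (measurable_R.pow_const _) _]
  calc _ ≤ ∑ w : Fin n → Fin m, (ENNReal.ofReal σp ^ u * (m : ℝ≥0∞)⁻¹) ^ n := by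
        refine Finset.sum_le_sum fun w _ => ?_
        rw [prodE h hP _ (fun _ x => R x ^ (s + u)) (fun _ => measurable_R.pow_const _), Finset.prod_const, Finset.card_range]
        gcongr
        exact int_pow h0 hx hu
    _ = _ := by
        simp only [Finset.sum_const, Finset.card_univ, nsmul_eq_mul, Fintype.card_pi, Fintype.card_fin, Finset.prod_const]
        push_cast
        calc _ = ((m : ℝ≥0∞) * (m : ℝ≥0∞)⁻¹) ^ n * (ENNReal.ofReal σp ^ u) ^ n := by ring
          _ = _ := by rw [mx hm, one_pow, one_mul]

lemma upper (hm : 0 < m) (h0 : 0 < σm) (h : σm < σp) (h1 : σp < 1)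
    (hP : IsProductLaw θ P) (hs : 0 < s)
    (hx : ∫⁻ l, R l ^ s ∂(labelM σm σp θ) = (m : ℝ≥0∞)⁻¹) (a : Fin m → E d)
    {t : ℝ} (ht : s < t) :
    ∀ᵐ ω ∂P, dimH (Fset a ω) ≤ ENNReal.ofReal t := by
  obtain ⟨u, hu, rfl⟩ : ∃ u, 0 < u ∧ t = s + u := ⟨t - s, by linarith, by ring⟩
  have ht0 : 0 < s + u := by linarith
  have hfin : ∫⁻ ω, ∑' n, Sn hm (s + u) n ω ∂P ≠ ⊤ := by
    rw [lintegral_tsum fun n => (measurable_Sn hm _ n).aemeasurable]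
    refine ne_top_of_le_ne_top ?_ (ENNReal.tsum_le_tsum fun n => ESn hm h0 h hP hx hu.le n)
    rw [ENNReal.tsum_geometric]
    exact ENNReal.inv_ne_top.2 (tsub_pos_of_lt (S_pow_lt h1 hu)).ne'
  filter_upwards [ae_lt_top (Measurable.ennreal_tsum fun n => measurable_Sn hm (s + u) n) hfin] with ω hω
  have hS0 : Tendsto (fun n => Sn hm (s + u) n ω) atTop (𝓝 0) := ENNReal.tendsto_atTop_zero_of_tsum_ne_top hω.ne
  set D : ℝ≥0∞ := ENNReal.ofReal (2 * (amax a * (1 - σp)⁻¹)) with hD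
  have hDt : D ≠ ⊤ := ENNReal.ofReal_ne_top
  let T : ∀ n : ℕ, (Fin n → Fin m) → Set (E d) := fun n w => piMap a ω '' {i | ∀ l : Fin n, i l.1 = w l}
  have hdiam : ∀ n w, Metric.ediam (T n w) ≤ (∏ l ∈ Finset.range n, R (ω (pre (wext hm w) l))) * D := by
    intro n w
    apply Metric.ediam_le
    rintro _ ⟨i, hi, rfl⟩ _ ⟨j, hj, rfl⟩
    have e1 : ∀ l < n, i l = j l := fun l hl => (hi ⟨l, hl⟩).trans (hj ⟨l, hl⟩).symm
    have e2 : ∀ l < n, wext hm w l = i l := fun l hl => (wext_apply hm w ⟨l, hl⟩).trans (hi ⟨l, hl⟩).symm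
    refine (edist_bd h0 h h1 a ω e1).trans (le_of_eq ?_)
    congr 1
    refine Finset.prod_congr rfl fun l hl => ?_
    rw [pre_congr e2 (Finset.mem_range.1 hl)]
  have key := Measure.hausdorffMeasure_le_liminf_sum (l := atTop) (s + u) (Fset a ω)
    (fun n : ℕ => ENNReal.ofReal σp ^ n * D) (by
      have := ENNReal.Tendsto.mul_const (b := D)
        (ENNReal.tendsto_pow_atTop_nhds_zero_of_lt_one (r := ENNReal.ofReal σp) (by simpa using h1)) (Or.inr hDt)
      simpa using this) T
    (Eventually.of_forall fun n w => (hdiam n w).trans (mul_le_mul' (by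
      calc _ ≤ ∏ l ∈ Finset.range n, ENNReal.ofReal σp := Finset.prod_le_prod' fun l _ => R_le _
        _ = _ := by simp) le_rfl))
    (Eventually.of_forall fun n => by
      rintro _ ⟨i, rfl⟩
      exact Set.mem_iUnion.2 ⟨fun l => i l.1, i, fun l => rfl, rfl⟩)
  have hlim : Tendsto (fun n => ∑ w, Metric.ediam (T n w) ^ (s + u)) atTop (𝓝 0) := by
    have hb : Tendsto (fun n => Sn hm (s + u) n ω * D ^ (s + u)) atTop (𝓝 0) := by
      have := ENNReal.Tendsto.mul_const (b := D ^ (s + u)) hS0 (Or.inr (by finiteness))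
      simpa using this
    refine tendsto_of_tendsto_of_tendsto_of_le_of_le tendsto_const_nhds hb (fun _ => zero_le) fun n => ?_
    dsimp only [Sn]
    rw [Finset.sum_mul]
    refine Finset.sum_le_sum fun w _ => ?_
    refine (ENNReal.rpow_le_rpow (hdiam n w) ht0.le).trans (le_of_eq ?_)
    rw [ENNReal.mul_rpow_of_nonneg _ _ ht0.le, ENNReal.prod_rpow_of_nonneg ht0.le]
  rw [hlim.liminf_eq] at key
  refine dimH_le_of_hausdorffMeasure_ne_top (d := (s + u).toNNReal) ?_
  rw [Real.coe_toNNReal _ ht0.le, le_antisymm key zero_le]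
  simp

lemma hx_of (hm : 0 < m) (h0 : 0 < σm) (h : σm < σp) 
    (hs : ((m : ℝ) / (σp - σm)) * (∫ r in σm..σp, r ^ s) = 1) :
    ∫⁻ l : Label d σm σp, R l ^ s ∂(labelM σm σp θ) = (m : ℝ≥0∞)⁻¹ := by
  haveI := unifSub_prob h
  unfold labelM
  rw [lintegral_prod _ (measurable_R.pow_const s).aemeasurable]
  simp only [R, lintegral_const, measure_univ, mul_one]
  rw [lintegral_unifSub (fun r => ENNReal.ofReal r ^ s)]
  have hI : IntegrableOn (fun r : ℝ => r ^ s) (Set.Ioo σm σp) := by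
    have : ContinuousOn (fun r : ℝ => r ^ s) (Set.Icc σm σp) := by
      intro r hr
      exact (Real.continuousAt_rpow_const r s (Or.inl (h0.trans_le hr.1).ne')).continuousWithinAt
    exact this.integrableOn_Icc.mono_set Set.Ioo_subset_Icc_self
  have e : ∫⁻ r in Set.Ioo σm σp, ENNReal.ofReal r ^ s = ENNReal.ofReal (∫ r in σm..σp, r ^ s) := by
    rw [intervalIntegral.integral_of_le h.le, integral_Ioc_eq_integral_Ioo,
      ofReal_integral_eq_lintegral_ofReal hI]
    · refine setLIntegral_congr_fun measurableSet_Ioo fun r hr => ?_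
      rw [ENNReal.ofReal_rpow_of_pos (h0.trans hr.1)]
    · refine (ae_restrict_iff' measurableSet_Ioo).2 (Eventually.of_forall fun r hr => ?_)
      exact Real.rpow_nonneg (h0.trans hr.1).le _
  have hpos : 0 < σp - σm := by linarith
  have hmp : (0 : ℝ) < m := by exact_mod_cast hm
  rw [e, ← ENNReal.ofReal_inv_of_pos hpos, ← ENNReal.ofReal_mul (by positivity), ← ENNReal.ofReal_natCast,
    ← ENNReal.ofReal_inv_of_pos hmp]
  congr 1
  field_simp
  field_simp at hs
  linarith

end prob
end RSS
end

/-- Theorem 2.2 (main theorem, dimension part): for `ℙ`-almost every `ω`,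
`dim_H F(ω) = min{s, d}`. -/
theorem stmt17 (d m : ℕ) (hd : 1 ≤ d) (hm : 2 ≤ m)
    (σm σp : ℝ) (hσ0 : 0 < σm) (hσ1 : σm ≤ σp) (hσ2 : σp < 1)
    (a : Fin m → E d) (ha : Function.Injective a)
    (θ : Measure (Od d)) (hθ1 : IsProbabilityMeasure θ) (hθ2 : θ.IsMulLeftInvariant)
    (P : Measure (Omega d m σm σp)) (hP1 : IsProbabilityMeasure P)
    (hP2 : IsProductLaw θ P)
    (s : ℝ) (hs0 : 0 < s)
    (hs : ((m : ℝ) / (σp - σm)) * (∫ r in σm..σp, r ^ s) = 1) :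
    ∀ᵐ ω ∂P, dimH (Fset a ω) = min (ENNReal.ofReal s) (d : ℝ≥0∞) := by
  have h : σm < σp := by
    rcases hσ1.lt_or_eq with h | h
    · exact h
    · rw [h] at hs; simp at hs
  have hx := RSS.hx_of (d := d) (θ := θ) (by omega : 0 < m) hσ0 h hs
  have hmin : 0 < min s (d : ℝ) := lt_min hs0 (by exact_mod_cast hd)
  have hup : ∀ᵐ ω ∂P, ∀ q : ℚ, s < q → dimH (Fset a ω) ≤ ENNReal.ofReal q := by
    rw [ae_all_iff]
    intro q
    by_cases hq : s < q
    · filter_upwards [RSS.upper (by omega) hσ0 h hσ2 hP2 hs0 hx a hq] with ω hω _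
      exact hω
    · exact Eventually.of_forall fun ω h' => absurd h' hq
  have hlo : ∀ᵐ ω ∂P, ∀ q : ℚ, 0 < (q : ℝ) ∧ (q : ℝ) < min s d → ENNReal.ofReal q ≤ dimH (Fset a ω) := by
    rw [ae_all_iff]
    intro q
    by_cases hq : 0 < (q : ℝ) ∧ (q : ℝ) < min s d
    · filter_upwards [RSS.lower hd hm hσ0 h hσ2 hP2 hs0 hx a ha hq.1 (lt_min_iff.1 hq.2).1 (lt_min_iff.1 hq.2).2] with ω hω _
      exact hω
    · exact Eventually.of_forall fun ω h' => absurd h' hq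
  have hdd : ∀ S : Set (E d), dimH S ≤ d := by
    intro S
    have := dimH_mono (Set.subset_univ S)
    rwa [Real.dimH_univ_eq_finrank, finrank_euclideanSpace_fin] at this
  filter_upwards [hup, hlo] with ω h1 h2
  have hfin : dimH (Fset a ω) ≠ ⊤ := ne_top_of_le_ne_top (by simp) (hdd _)
  apply le_antisymm
  · refine le_min ?_ (hdd _)
    rw [← ENNReal.ofReal_toReal hfin]
    apply ENNReal.ofReal_le_ofReal
    refine le_of_forall_gt_imp_ge_of_dense fun c hc => ?_
    obtain ⟨q, hq1, hq2⟩ := exists_rat_btwn hc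
    have := ENNReal.toReal_mono ENNReal.ofReal_ne_top (h1 q hq1)
    rw [ENNReal.toReal_ofReal (hs0.trans hq1).le] at this
    linarith
  · have e : min (ENNReal.ofReal s) (d : ℝ≥0∞) = ENNReal.ofReal (min s d) := by
      rw [ENNReal.ofReal_min, ENNReal.ofReal_natCast]
    rw [e, ← ENNReal.ofReal_toReal hfin]
    apply ENNReal.ofReal_le_ofReal
    refine le_of_forall_lt_imp_le_of_dense fun c hc => ?_
    obtain ⟨q, hq1, hq2⟩ := exists_rat_btwn (max_lt hc hmin)
    have hq0 : (0 : ℝ) < q := (le_max_right _ _).trans_lt hq1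
    have := ENNReal.toReal_mono hfin (h2 q ⟨hq0, hq2⟩)
    rw [ENNReal.toReal_ofReal hq0.le] at this
    have := (le_max_left c 0).trans_lt hq1
    linarith
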